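/- arXiv:2007.01352 — 3 statements merged into one kernel-verified Lean document; each statement's English description precedes it below -/
import Mathlib

section
/- Let G be a finite subgroup of PGL(2,ℂ). Then G is either cyclic, or isomorphic to a dihedral group, or isomorphic to the alternating group A₄, or to the symmetric group S₄, or to the alternating group A₅. -/
open Matrix

/-- `PGL(2, ℂ)`: the quotient of `GL(2, ℂ)` by its center (the nonzero scalar matrices). -/
abbrev PGL2C : Type :=
  GL (Fin 2) ℂ ⧸ Subgroup.center (GL (Fin 2) ℂ)


namespace PGLAux
open Subgroup

lemma sylow_card {G : Type*} [Group G] [Finite G] (p k m : ℕ) [hp : Fact p.Prime]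
    (hN : Nat.card G = p ^ k * m) (hm : ¬ p ∣ m) (P : Sylow p G) :
    Nat.card P = p ^ k := by
  rw [P.card_eq_multiplicity, hN]
  have h0 : m ≠ 0 := by rintro rfl; simp at hm
  rw [Nat.factorization_mul (pow_ne_zero _ hp.1.ne_zero) h0, hp.1.factorization_pow]
  simp [Nat.factorization_eq_zero_of_not_dvd hm]

lemma sylow_emb {G : Type*} [Group G] [Finite G] (p m : ℕ) [Fact p.Prime]
    (hm : Nat.card (Sylow p G) = m)
    (hK : ∀ K : Subgroup G, K.Normal → Nat.card K * m ∣ Nat.card G → Nat.card K = 1) :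
    ∃ f : G →* Equiv.Perm (Fin m), Function.Injective f := by
  let φ := MulAction.toPermHom G (Sylow p G)
  obtain ⟨P⟩ : Nonempty (Sylow p G) := inferInstance
  have h1 : Nat.card φ.ker = 1 := by
    apply hK _ inferInstance
    have hle : φ.ker ≤ normalizer (P : Set G) := by
      rw [← P.stabilizer_eq_normalizer]
      intro g hg
      have : φ g P = (1 : Equiv.Perm (Sylow p G)) P := by rw [MonoidHom.mem_ker.1 hg]
      simpa [φ] using this
    have h2 := P.card_eq_index_normalizer
    have h3 := Subgroup.card_mul_index (normalizer (P : Set G))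
    rw [← h3, ← hm, h2]
    exact Nat.mul_dvd_mul (Subgroup.card_dvd_of_le hle) dvd_rfl
  have hinj : Function.Injective φ := (MonoidHom.ker_eq_bot_iff φ).1 (Subgroup.card_eq_one.1 h1)
  have e : Sylow p G ≃ Fin m := (Finite.equivFinOfCardEq hm)
  exact ⟨(e.permCongrHom).toMonoidHom.comp φ, e.permCongrHom.injective.comp hinj⟩

lemma sylow_normal {G : Type*} [Group G] [Finite G] (p : ℕ) [Fact p.Prime]
    (hm : Nat.card (Sylow p G) = 1) (P : Sylow p G) : (P : Subgroup G).Normal := by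
  have : Subsingleton (Sylow p G) := (Nat.card_eq_one_iff_unique.1 hm).1
  exact P.normal_of_subsingleton

lemma iso_alt {G : Type*} [Group G] [Finite G] (m : ℕ)
    (h : 2 * Nat.card G = m.factorial)
    (f : G →* Equiv.Perm (Fin m)) (hf : Function.Injective f) :
    Nonempty (G ≃* alternatingGroup (Fin m)) := by
  have e := MonoidHom.ofInjective hf
  have h1 : f.range.index = 2 := by
    have h2 := Subgroup.card_mul_index f.range
    rw [← Nat.card_congr e.toEquiv, Nat.card_perm, Nat.card_fin, ← h, mul_comm] at h2
    exact Nat.eq_of_mul_eq_mul_right Nat.card_pos h2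
  have h3 := Equiv.Perm.eq_alternatingGroup_of_index_eq_two h1
  exact ⟨e.trans (MulEquiv.subgroupCongr h3)⟩

lemma n3 {G : Type*} [Group G] [Finite G] (k : ℕ) (hk : k = 4 ∨ k = 8)
    (hN : Nat.card G = 3 * k)
    (hK : ∀ K : Subgroup G, K.Normal → Nat.card K ≠ 3) : Nat.card (Sylow 3 G) = 4 := by
  have : Fact (Nat.Prime 3) := ⟨by norm_num⟩
  obtain ⟨P⟩ : Nonempty (Sylow 3 G) := inferInstance
  have hP : Nat.card P = 3 := by
    simpa using sylow_card 3 1 k (by simpa using hN) (by omega) P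
  have h1 : Nat.card (Sylow 3 G) ≠ 1 := fun h => hK _ (sylow_normal 3 h P) hP
  have h2 := card_sylow_modEq_one 3 G
  have h3 := P.card_dvd_index
  have h4 := Subgroup.card_mul_index (P : Subgroup G)
  have hP' : Nat.card (P : Subgroup G) = 3 := hP
  rw [hP', hN] at h4
  have h5 : (P : Subgroup G).index = k := by omega
  rw [h5] at h3
  have h6 : Nat.card (Sylow 3 G) ≤ 8 := (Nat.le_of_dvd (by omega) h3).trans (by omega)
  unfold Nat.ModEq at h2
  generalize Nat.card (Sylow 3 G) = n at *
  interval_cases n <;> omega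

lemma iso_A4 {G : Type*} [Group G] [Finite G] (hN : Nat.card G = 12)
    (hK : ∀ K : Subgroup G, K.Normal → Nat.card K ≠ 3) :
    Nonempty (G ≃* alternatingGroup (Fin 4)) := by
  have : Fact (Nat.Prime 3) := ⟨by norm_num⟩
  obtain ⟨f, hf⟩ := sylow_emb 3 4 (n3 4 (by simp) hN hK) (by
    intro K h1 h2
    rw [hN] at h2
    have := Nat.dvd_of_mul_dvd_mul_right (k := 4) (m := Nat.card K) (n := 3) (by norm_num) h2
    rcases (Nat.dvd_prime (by norm_num)).1 this with h | h
    · exact h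
    · exact absurd h (hK K h1))
  exact iso_alt 4 (by rw [hN]; rfl) f hf

lemma iso_S4 {G : Type*} [Group G] [Finite G] (hN : Nat.card G = 24)
    (hK : ∀ K : Subgroup G, K.Normal → Nat.card K ≠ 2 ∧ Nat.card K ≠ 3 ∧ Nat.card K ≠ 6) :
    Nonempty (G ≃* Equiv.Perm (Fin 4)) := by
  have : Fact (Nat.Prime 3) := ⟨by norm_num⟩
  obtain ⟨f, hf⟩ := sylow_emb 3 4 (n3 8 (by simp) hN fun K h => (hK K h).2.1) (by
    intro K h1 h2
    rw [hN] at h2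
    have h3 := Nat.dvd_of_mul_dvd_mul_right (k := 4) (m := Nat.card K) (n := 6) (by norm_num) h2
    have h4 := Nat.le_of_dvd (by omega) h3
    have h5 := hK K h1
    generalize Nat.card K = n at *
    interval_cases n <;> omega)
  refine ⟨MulEquiv.ofBijective f ((Nat.bijective_iff_injective_and_card f).2 ⟨hf, ?_⟩)⟩
  rw [hN, Nat.card_perm, Nat.card_fin]; rfl

lemma iso_A5 {G : Type*} [Group G] [Finite G] (hN : Nat.card G = 60)
    (hK : ∀ K : Subgroup G, K.Normal → Nat.card K = 1 ∨ Nat.card K = 60) :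
    Nonempty (G ≃* alternatingGroup (Fin 5)) := by
  have : Fact (Nat.Prime 2) := ⟨by norm_num⟩
  obtain ⟨P⟩ : Nonempty (Sylow 2 G) := inferInstance
  have hP : Nat.card (P : Subgroup G) = 4 := by
    simpa using sylow_card 2 2 15 (by simpa using hN) (by omega) P
  have h1 : Nat.card (Sylow 2 G) ≠ 1 := fun h => by
    have := hK _ (sylow_normal 2 h P)
    omega
  have h2 := card_sylow_modEq_one 2 G
  have h3 := P.card_dvd_index
  have h4 := Subgroup.card_mul_index (P : Subgroup G)
  rw [hP, hN] at h4
  have h5 : (P : Subgroup G).index = 15 := by omega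
  rw [h5] at h3
  have h6 := Nat.le_of_dvd (by omega) h3
  unfold Nat.ModEq at h2
  have key : ∀ K : Subgroup G, K.Normal → Nat.card K * Nat.card (Sylow 2 G) ∣ Nat.card G →
      Nat.card K = 1 := by
    intro K hn hd
    rcases hK K hn with h | h
    · exact h
    · rw [h, hN] at hd
      have := Nat.le_of_dvd (by omega) hd
      have : 0 < Nat.card (Sylow 2 G) := Nat.card_pos
      omega
  have n3 : Nat.card (Sylow 2 G) ≠ 3 := by
    intro h
    rw [h] at key
    obtain ⟨f, hf⟩ := sylow_emb 2 3 h key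
    have := Nat.card_le_card_of_injective f hf
    rw [hN, Nat.card_perm, Nat.card_fin] at this
    simp [Nat.factorial] at this
  have n15 : Nat.card (Sylow 2 G) ≠ 15 := by
    intro h
    rw [P.card_eq_index_normalizer] at h
    have h7 := Subgroup.card_mul_index (normalizer (P : Set G))
    rw [h, hN] at h7
    have h8 : (P : Subgroup G) = normalizer (P : Set G) := by
      apply Subgroup.eq_of_le_of_card_ge
      · exact Subgroup.le_normalizer
      · omega
    have h9 : IsMulCommutative (P : Subgroup G) :=
      IsPGroup.isMulCommutative_of_card_eq_prime_sq (p := 2) hP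
    have h10 : normalizer (P : Set G) ≤ centralizer (P : Set G) := by
      rw [← h8]
      exact Subgroup.le_centralizer _
    have h11 := (MonoidHom.ker_transferSylow_isComplement' P h10).card_mul_card
    have := hK (MonoidHom.transferSylow P h10).ker inferInstance
    rw [hP, hN] at h11
    omega
  have h7 : Nat.card (Sylow 2 G) = 5 := by
    generalize Nat.card (Sylow 2 G) = n at *
    interval_cases n <;> omega
  rw [h7] at key
  obtain ⟨f, hf⟩ := sylow_emb 2 5 h7 key
  exact iso_alt 5 (by rw [hN]; rfl) f hf

lemma iso_dihedral {G : Type*} [Group G] [Finite G] (C : Subgroup G) [IsCyclic C]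
    (hC : C.index = 2) (h : ∀ g ∉ C, g * g = 1) :
    ∃ n : ℕ, 0 < n ∧ Nonempty (G ≃* DihedralGroup n) := by
  obtain ⟨⟨r, hr⟩, hgen⟩ := IsCyclic.exists_generator (α := C)
  have hs : ∃ s, s ∉ C := by
    by_contra! hh
    have : C = ⊤ := by ext; simp [hh]
    rw [this] at hC; simp at hC
  obtain ⟨s, hs⟩ := hs
  have hss : s * s = 1 := h s hs
  have hord : orderOf r = Nat.card C := by
    rw [← orderOf_eq_card_of_forall_mem_zpowers hgen]; simp
  set n := Nat.card C with hn
  have hnpos : 0 < n := Nat.card_pos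
  have : NeZero n := ⟨hnpos.ne'⟩
  have hconj : ∀ k : ℕ, s * r ^ k * s = (r ^ k)⁻¹ := by
    intro k
    have h1 : s * r ^ k ∉ C := fun hh => hs ((C.mul_mem_cancel_right (C.pow_mem hr k)).1 hh)
    have h2 := h _ h1
    rw [eq_inv_iff_mul_eq_one, mul_assoc]
    exact h2
  let P : ZMod n → G := fun i => r ^ i.val
  have Padd : ∀ i j, P (i + j) = P i * P j := by
    intro i j
    simp only [P, ← pow_add]
    rw [pow_eq_pow_iff_modEq, hord, ZMod.val_add]
    exact Nat.mod_modEq _ _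
  have P0 : P 0 = 1 := by simp [P]
  have Psub : ∀ i j, P (i - j) = (P j)⁻¹ * P i := by
    intro i j
    rw [eq_inv_mul_iff_mul_eq, ← Padd]; simp
  have Pconj : ∀ i, s * P i * s = (P i)⁻¹ := fun i => hconj _
  have Pcomm : ∀ i j, P i * P j = P j * P i := fun i j => by rw [← Padd, ← Padd, add_comm]
  have Pinj : Function.Injective P := by
    intro i j hij
    simp only [P] at hij
    rw [pow_eq_pow_iff_modEq, hord, Nat.ModEq, Nat.mod_eq_of_lt (ZMod.val_lt i),
      Nat.mod_eq_of_lt (ZMod.val_lt j)] at hij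
    exact ZMod.val_injective n hij
  have PC : ∀ i, P i ∈ C := fun i => C.pow_mem hr _
  have hP2 : ∀ i, P i * s = s * (P i)⁻¹ := fun i => by
    rw [← Pconj, ← mul_assoc, ← mul_assoc, hss, one_mul]
  let F : DihedralGroup n → G := fun x => match x with
    | .r i => P i
    | .sr i => s * P i
  have hmul : ∀ x y, F (x * y) = F x * F y := by
    rintro (i | i) (j | j)
    · simp only [DihedralGroup.r_mul_r, F, Padd]
    · simp only [DihedralGroup.r_mul_sr, F, Psub]
      rw [← mul_assoc, ← mul_assoc, hP2]
    · simp only [DihedralGroup.sr_mul_r, F, Padd, mul_assoc]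
    · simp only [DihedralGroup.sr_mul_sr, F, Psub]
      rw [← mul_assoc, Pconj]
  let f : DihedralGroup n →* G := MonoidHom.mk' F hmul
  have hinj : Function.Injective f := by
    rintro (i | i) (j | j) hij
    · exact congrArg _ (Pinj hij)
    · exact absurd ((show P i = s * P j from hij) ▸ PC i : s * P j ∈ C) fun hh => hs ((C.mul_mem_cancel_right (PC j)).1 hh)
    · exact absurd ((show s * P i = P j from hij).symm ▸ PC j : s * P i ∈ C) fun hh => hs ((C.mul_mem_cancel_right (PC i)).1 hh)
    · exact congrArg _ (Pinj (mul_left_cancel hij))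
  refine ⟨n, hnpos, ⟨(MulEquiv.ofBijective f ((Nat.bijective_iff_injective_and_card f).2 ⟨hinj, ?_⟩)).symm⟩⟩
  rw [DihedralGroup.nat_card, ← Subgroup.card_mul_index C, hC, mul_comm]

end PGLAux

namespace PGLAux
open Subgroup

lemma arith_sorted (N a b c p q r : ℕ) (hp : 2 ≤ p) (hpq : p ≤ q) (hqr : q ≤ r)
    (ha : a * p = N) (hb : b * q = N) (hc : c * r = N) (h : a + b + c = N + 2) :
    c = 2 ∨ (p = 2 ∧ q = 3 ∧ r = 3 ∧ N = 12) ∨ (p = 2 ∧ q = 3 ∧ r = 4 ∧ N = 24) ∨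
      (p = 2 ∧ q = 3 ∧ r = 5 ∧ N = 60) := by
  have ga : ∀ k, k ≤ p → a * k ≤ N := fun k hk => ha ▸ Nat.mul_le_mul_left a hk
  have gb : ∀ k, k ≤ q → b * k ≤ N := fun k hk => hb ▸ Nat.mul_le_mul_left b hk
  have gc : ∀ k, k ≤ r → c * k ≤ N := fun k hk => hc ▸ Nat.mul_le_mul_left c hk
  have hp2 : p = 2 := by
    by_contra hne
    have h1 := ga 3 (by omega)
    have h2 := gb 3 (by omega)
    have h3 := gc 3 (by omega)
    omega
  subst hp2
  have hq3 : q ≤ 3 := by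
    by_contra hne
    have h2 := gb 4 (by omega)
    have h3 := gc 4 (by omega)
    omega
  interval_cases q
  · left; omega
  · have hr : r ≤ 5 := by
      by_contra hne
      have h3 := gc 6 (by omega)
      omega
    interval_cases r <;> omega

section
variable {G X : Type*} [Group G] [Finite G] [MulAction G X]

open MulAction

lemma count (h1 : ∀ g : G, g ≠ 1 → ∃ p q : X, p ≠ q ∧ ∀ x, g • x = x ↔ x = p ∨ x = q) :
    ∃ S : Finset X, (∀ x ∈ S, 2 ≤ Nat.card (stabilizer G x)) ∧
      ∀ K : Subgroup G, K.Normal → 2 * (Nat.card K - 1) =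
        ∑ x ∈ S, Nat.card (orbit G x) * (Nat.card ↥(K ⊓ stabilizer G x) - 1) := by
  classical
  have := Fintype.ofFinite G
  have hYfin : {x : X | ∃ g : G, g ≠ 1 ∧ g • x = x}.Finite := by
    have : {x : X | ∃ g : G, g ≠ 1 ∧ g • x = x} = ⋃ g : {g : G // g ≠ 1}, {x | g.1 • x = x} := by
      ext x; simp
    rw [this]
    apply Set.finite_iUnion
    rintro ⟨g, hg⟩
    obtain ⟨p, q, -, h⟩ := h1 g hg
    apply (Set.toFinite {p, q}).subset
    intro x hx
    simpa using (h x).1 hx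
  set Y := hYfin.toFinset with hY
  have memY : ∀ x, x ∈ Y ↔ ∃ g : G, g ≠ 1 ∧ g • x = x := by simp [hY]
  have Ysmul : ∀ (x) (k : G), x ∈ Y → k • x ∈ Y := by
    intro x k hx
    obtain ⟨g, hg, hgx⟩ := (memY x).1 hx
    refine (memY _).2 ⟨k * g * k⁻¹, ?_, ?_⟩
    · simpa [mul_inv_eq_one] using hg
    · rw [smul_smul, inv_mul_cancel_right, mul_smul, hgx]
  let π : X → orbitRel.Quotient G X := Quotient.mk _
  let Ω := Y.image π
  have πeq : ∀ x y, π x = π y ↔ x ∈ orbit G y := by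
    intro x y
    rw [← orbitRel_apply]
    exact Quotient.eq
  have outY : ∀ ω ∈ Ω, ω.out ∈ Y ∧ π ω.out = ω := by
    intro ω hω
    have h2 : π ω.out = ω := Quotient.out_eq ω
    refine ⟨?_, h2⟩
    obtain ⟨x, hx, rfl⟩ := Finset.mem_image.1 hω
    obtain ⟨k, hk⟩ := (πeq _ _).1 h2
    rw [← hk]
    exact Ysmul x k hx
  refine ⟨Ω.image Quotient.out, ?_, ?_⟩
  · intro x hx
    obtain ⟨ω, hω, rfl⟩ := Finset.mem_image.1 hx
    obtain ⟨g, hg, hgx⟩ := (memY _).1 (outY ω hω).1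
    have : Nontrivial (stabilizer G ω.out) := ⟨⟨⟨g, hgx⟩, 1, fun h => hg (congrArg Subtype.val h)⟩⟩
    exact Finite.one_lt_card
  intro K hK
  let c : X → ℕ := fun x => (Finset.univ.filter fun g : G => g ∈ K ∧ g ≠ 1 ∧ g • x = x).card
  have cardm1 : ∀ H : Subgroup G, (Finset.univ.filter fun g : G => g ∈ H ∧ g ≠ 1).card
      = Nat.card H - 1 := by
    intro H
    have : (Finset.univ.filter fun g : G => g ∈ H ∧ g ≠ 1)
      = (Finset.univ.filter fun g : G => g ∈ H).erase 1 := by ext; simp [and_comm]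
    rw [this, Finset.card_erase_of_mem (by simp [H.one_mem]), Nat.card_eq_fintype_card,
      Fintype.card_subtype]
  have cval : ∀ x, c x = Nat.card ↥(K ⊓ stabilizer G x) - 1 := by
    intro x
    rw [← cardm1]
    refine congrArg Finset.card ?_
    ext g
    simp [Subgroup.mem_inf, mem_stabilizer_iff]
    tauto
  have cconst : ∀ (k : G) x, c (k • x) = c x := by
    intro k x
    symm
    apply Finset.card_bij (fun g _ => k * g * k⁻¹)
    · intro g hg
      simp only [Finset.mem_filter, Finset.mem_univ, true_and] at hg ⊢
      refine ⟨hK.conj_mem g hg.1 k, ?_, ?_⟩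
      · simpa [mul_inv_eq_one] using hg.2.1
      · rw [smul_smul, inv_mul_cancel_right, mul_smul, hg.2.2]
    · intro a _ b _ h
      simpa using h
    · intro g hg
      simp only [Finset.mem_filter, Finset.mem_univ, true_and] at hg ⊢
      refine ⟨k⁻¹ * g * k, ⟨by simpa using hK.conj_mem g hg.1 k⁻¹, ?_, ?_⟩, by group⟩
      · intro h
        apply hg.2.1
        rw [mul_assoc, inv_mul_eq_one] at h
        simpa using h.symm
      · rw [mul_smul, mul_smul, hg.2.2, inv_smul_smul]
  have e1 : ∑ x ∈ Y, c x = 2 * (Nat.card K - 1) := by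
    have := Finset.sum_card_bipartiteAbove_eq_sum_card_bipartiteBelow
      (s := Y) (t := Finset.univ.filter fun g : G => g ∈ K ∧ g ≠ 1) (fun x g => g • x = x)
    have e2 : ∀ x, (Finset.bipartiteAbove (fun (x : X) (g : G) => g • x = x)
        (Finset.univ.filter fun g : G => g ∈ K ∧ g ≠ 1) x).card = c x := by
      intro x
      simp only [Finset.bipartiteAbove, Finset.filter_filter, c, and_assoc]
    simp only [e2] at this
    rw [this, ← cardm1, mul_comm, ← smul_eq_mul]
    apply Finset.sum_const_nat
    intro g hg
    simp only [Finset.mem_filter, Finset.mem_univ, true_and] at hg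
    obtain ⟨p, q, hpq, h⟩ := h1 g hg.2
    rw [← Finset.card_pair hpq]
    congr 1
    ext x
    simp only [Finset.mem_bipartiteBelow, h, Finset.mem_insert, Finset.mem_singleton]
    rw [memY]
    exact ⟨fun hh => hh.2, fun hh => ⟨⟨g, hg.2, (h x).2 hh⟩, hh⟩⟩
  rw [← e1, Finset.sum_image (fun a _ b _ h => Quotient.out_injective h),
    ← Finset.sum_fiberwise_of_maps_to (t := Ω) (g := π) (fun x hx => Finset.mem_image_of_mem _ hx)]
  apply Finset.sum_congr rfl
  intro ω hω
  rw [← cval]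
  have hf : ∀ x, x ∈ Y.filter (fun x => π x = ω) ↔ x ∈ orbit G ω.out := by
    intro x
    rw [Finset.mem_filter, ← πeq, (outY ω hω).2]
    refine ⟨fun h => h.2, fun h => ⟨?_, h⟩⟩
    rw [← (outY ω hω).2, πeq] at h
    obtain ⟨k, hk⟩ := h
    rw [← hk]; exact Ysmul _ k (outY ω hω).1
  have hcard : (Y.filter (fun x => π x = ω)).card = Nat.card (orbit G ω.out) := by
    rw [← Nat.card_eq_finsetCard]
    exact Nat.card_congr (Equiv.subtypeEquivRight hf)
  rw [← hcard]
  apply Finset.sum_const_nat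
  intro x hx
  obtain ⟨k, hk⟩ := (hf x).1 hx
  rw [← hk]; exact cconst k _

lemma three (x y z : X) (hN2 : 2 ≤ Nat.card G)
    (hx : 2 ≤ Nat.card (stabilizer G x))
    (hxy : Nat.card (stabilizer G x) ≤ Nat.card (stabilizer G y))
    (hyz : Nat.card (stabilizer G y) ≤ Nat.card (stabilizer G z))
    (hK : ∀ K : Subgroup G, K.Normal → 2 * (Nat.card K - 1) =
      Nat.card (orbit G x) * (Nat.card ↥(K ⊓ stabilizer G x) - 1) +
      Nat.card (orbit G y) * (Nat.card ↥(K ⊓ stabilizer G y) - 1) +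
      Nat.card (orbit G z) * (Nat.card ↥(K ⊓ stabilizer G z) - 1)) :
    (∃ z : X, Nat.card (orbit G z) = 2) ∨ Nonempty (G ≃* alternatingGroup (Fin 4)) ∨
      Nonempty (G ≃* Equiv.Perm (Fin 4)) ∨
      Nonempty (G ≃* alternatingGroup (Fin 5)) := by
  have os : ∀ x : X, Nat.card (orbit G x) * Nat.card (stabilizer G x) = Nat.card G := by
    intro x
    rw [← Nat.card_prod]
    exact Nat.card_congr (orbitProdStabilizerEquivGroup G x)
  have hd : ∀ (K : Subgroup G) (x : X), Nat.card ↥(K ⊓ stabilizer G x) ∣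
    Nat.card (stabilizer G x) := fun K x => card_dvd_of_le inf_le_right
  have ox := os x
  have oy := os y
  have oz := os z
  have htop := hK ⊤ inferInstance
  simp only [top_inf_eq, Subgroup.card_top, Nat.mul_sub, ox, oy, oz, mul_one] at htop
  have lx := Nat.le_of_dvd (by omega) (Dvd.intro _ ox)
  have ly := Nat.le_of_dvd (by omega) (Dvd.intro _ oy)
  have lz := Nat.le_of_dvd (by omega) (Dvd.intro _ oz)
  have key : ∀ (K : Subgroup G) (x : X) (r : ℕ), Nat.card (stabilizer G x) = r →
      Nat.card ↥(K ⊓ stabilizer G x) ∣ r := fun K x r h => h ▸ hd K x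
  rcases arith_sorted _ _ _ _ _ _ _ hx hxy hyz ox oy oz (by omega) with
    h | ⟨h1, h2, h3, h4⟩ | ⟨h1, h2, h3, h4⟩ | ⟨h1, h2, h3, h4⟩
  · exact Or.inl ⟨z, h⟩
  all_goals
    rw [h1, h4] at ox
    rw [h2, h4] at oy
    rw [h3, h4] at oz
  · obtain ⟨qx, qy, qz⟩ : Nat.card (orbit G x) = 6 ∧ Nat.card (orbit G y) = 4 ∧
      Nat.card (orbit G z) = 4 := by omega
    refine Or.inr (Or.inl (iso_A4 h4 fun K hn => ?_))
    have h5 := hK K hn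
    have d1 := key K x _ h1
    have d2 := key K y _ h2
    have d3 := key K z _ h3
    rw [qx, qy, qz] at h5
    rw [Nat.dvd_prime (by norm_num)] at d1 d2 d3
    rcases d1 with d1 | d1 <;> rcases d2 with d2 | d2 <;> rcases d3 with d3 | d3 <;>
      rw [d1, d2, d3] at h5 <;> omega
  · obtain ⟨qx, qy, qz⟩ : Nat.card (orbit G x) = 12 ∧ Nat.card (orbit G y) = 8 ∧
      Nat.card (orbit G z) = 6 := by omega
    refine Or.inr (Or.inr (Or.inl (iso_S4 h4 fun K hn => ?_)))
    have h5 := hK K hn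
    have d1 := key K x _ h1
    have d2 := key K y _ h2
    have d3 := key K z _ h3
    rw [qx, qy, qz] at h5
    rw [Nat.dvd_prime (by norm_num)] at d1 d2
    rw [show 4 = 2 ^ 2 by norm_num, Nat.dvd_prime_pow (by norm_num)] at d3
    obtain ⟨k, hk, d3⟩ := d3
    interval_cases k <;>
    rcases d1 with d1 | d1 <;> rcases d2 with d2 | d2 <;>
      rw [d1, d2, d3] at h5 <;> omega
  · obtain ⟨qx, qy, qz⟩ : Nat.card (orbit G x) = 30 ∧ Nat.card (orbit G y) = 20 ∧
      Nat.card (orbit G z) = 12 := by omega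
    refine Or.inr (Or.inr (Or.inr (iso_A5 h4 fun K hn => ?_)))
    have h5 := hK K hn
    have d1 := key K x _ h1
    have d2 := key K y _ h2
    have d3 := key K z _ h3
    have hdK := Subgroup.card_subgroup_dvd_card K
    rw [h4] at hdK
    rw [qx, qy, qz] at h5
    rw [Nat.dvd_prime (by norm_num)] at d1 d2 d3
    have hpos : 0 < Nat.card K := Nat.card_pos
    have hv : Nat.card K = 1 ∨ Nat.card K = 16 ∨ Nat.card K = 21 ∨ Nat.card K = 25 ∨
        Nat.card K = 36 ∨ Nat.card K = 40 ∨ Nat.card K = 45 ∨ Nat.card K = 60 := by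
      rcases d1 with d1 | d1 <;> rcases d2 with d2 | d2 <;> rcases d3 with d3 | d3 <;>
        rw [d1, d2, d3] at h5 <;> omega
    rcases hv with h | h | h | h | h | h | h | h <;> rw [h] at hdK ⊢ <;> omega

theorem abstract_main
    (h1 : ∀ g : G, g ≠ 1 → ∃ p q : X, p ≠ q ∧ ∀ x, g • x = x ↔ x = p ∨ x = q)
    (hcyc : ∀ x : X, IsCyclic (stabilizer G x)) :
    IsCyclic G ∨
      (∃ n : ℕ, 0 < n ∧ Nonempty (G ≃* DihedralGroup n)) ∨
      Nonempty (G ≃* alternatingGroup (Fin 4)) ∨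
      Nonempty (G ≃* Equiv.Perm (Fin 4)) ∨
      Nonempty (G ≃* alternatingGroup (Fin 5)) := by
  classical
  rcases (Nat.lt_or_eq_of_le (Nat.card_pos (α := G))).symm with hN | hN
  · left
    have : Subsingleton G := (Nat.card_eq_one_iff_unique.1 hN.symm).1
    infer_instance
  have os : ∀ x : X, Nat.card (orbit G x) * Nat.card (stabilizer G x) = Nat.card G := by
    intro x
    rw [← Nat.card_prod]
    exact Nat.card_congr (orbitProdStabilizerEquivGroup G x)
  have opos : ∀ x : X, 0 < Nat.card (orbit G x) := fun x => by
    rcases Nat.eq_zero_or_pos (Nat.card (orbit G x)) with h | h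
    · have := os x; rw [h] at this; omega
    · exact h
  have hdih : (∃ z : X, Nat.card (orbit G z) = 2) →
      ∃ n : ℕ, 0 < n ∧ Nonempty (G ≃* DihedralGroup n) := by
    rintro ⟨z, hz⟩
    have := hcyc z
    refine iso_dihedral (stabilizer G z) ?_ ?_
    · rw [index_stabilizer, Set.ncard_def, Set.encard, ← hz]; rfl
    · intro g hg
      have hgz : g • z ≠ z := hg
      obtain ⟨u, v, huv, hfix⟩ := h1 g (by rintro rfl; simp at hgz)
      have hggz : g • g • z = z := by
        by_contra hne
        have hne2 : g • g • z ≠ g • z := fun h => hgz (smul_left_cancel g h)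
        obtain ⟨w, -, hw⟩ := (Nat.card_eq_two_iff' (⟨g • z, mem_orbit z g⟩ : orbit G z)).1 hz
        have e1 := hw ⟨z, mem_orbit_self z⟩ (fun h => hgz (congrArg Subtype.val h).symm)
        have e2 := hw ⟨g • g • z, by rw [smul_smul]; exact mem_orbit z _⟩
          (fun h => hne2 (congrArg Subtype.val h))
        exact hne (congrArg Subtype.val (e2.trans e1.symm))
      by_contra hne
      obtain ⟨u', v', huv', hfix'⟩ := h1 (g * g) hne
      have a1 := (hfix' z).1 (by rw [mul_smul, hggz])
      have gu := (hfix u).2 (Or.inl rfl)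
      have gv := (hfix v).2 (Or.inr rfl)
      have a2 := (hfix' u).1 (by rw [mul_smul, gu, gu])
      have a3 := (hfix' v).1 (by rw [mul_smul, gv, gv])
      have b1 : z ≠ u := fun h => hgz (h ▸ gu)
      have b2 : z ≠ v := fun h => hgz (h ▸ gv)
      grind
  obtain ⟨S, hS, hK⟩ := count h1
  have htop := hK ⊤ inferInstance
  simp only [top_inf_eq, Subgroup.card_top, Nat.mul_sub, os, mul_one] at htop
  have hle : ∀ x ∈ S, 2 * Nat.card (orbit G x) ≤ Nat.card G := by
    intro x hx
    rw [← os x, mul_comm]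
    exact Nat.mul_le_mul_left _ (hS x hx)
  have hc3 : S.card ≤ 3 := by
    by_contra hc
    have h2 : S.card * Nat.card G ≤ ∑ x ∈ S, 2 * (Nat.card G - Nat.card (orbit G x)) := by
      rw [← smul_eq_mul]
      apply Finset.card_nsmul_le_sum
      intro x hx
      have := hle x hx
      omega
    rw [← Finset.mul_sum, ← htop] at h2
    have h3 : 4 * Nat.card G ≤ S.card * Nat.card G := Nat.mul_le_mul_right _ (by omega)
    omega
  obtain hc | hc | hc | hc : S.card = 0 ∨ S.card = 1 ∨ S.card = 2 ∨ S.card = 3 := by omega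
  · rw [Finset.card_eq_zero.1 hc] at htop
    simp at htop; omega
  · obtain ⟨x, rfl⟩ := Finset.card_eq_one.1 hc
    have := opos x
    rw [Finset.sum_singleton] at htop; omega
  · obtain ⟨x, y, hxy, rfl⟩ := Finset.card_eq_two.1 hc
    rw [Finset.sum_pair hxy] at htop
    have p1 := opos x
    have p2 := opos y
    have l1 := hle x (by simp)
    have l2 := hle y (by simp)
    have hx : Nat.card (orbit G x) = 1 := by omega
    left
    have e := os x
    rw [hx, one_mul] at e
    have ht : stabilizer G x = ⊤ := Subgroup.eq_top_of_card_eq _ e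
    have := hcyc x
    rw [ht] at this
    exact (isCyclic_of_surjective _ (Subgroup.topEquiv (G := G)).surjective)
  · right
    obtain ⟨x, y, z, hxy, hxz, hyz, rfl⟩ := Finset.card_eq_three.1 hc
    have hK' : ∀ K : Subgroup G, K.Normal → 2 * (Nat.card K - 1) =
      Nat.card (orbit G x) * (Nat.card ↥(K ⊓ stabilizer G x) - 1) +
      Nat.card (orbit G y) * (Nat.card ↥(K ⊓ stabilizer G y) - 1) +
      Nat.card (orbit G z) * (Nat.card ↥(K ⊓ stabilizer G z) - 1) := by
      intro K hn
      rw [hK K hn, Finset.sum_insert (by simp [hxy, hxz]), Finset.sum_pair hyz]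
      ring
    suffices (∃ z : X, Nat.card (orbit G z) = 2) ∨ Nonempty (G ≃* alternatingGroup (Fin 4)) ∨
      Nonempty (G ≃* Equiv.Perm (Fin 4)) ∨
      Nonempty (G ≃* alternatingGroup (Fin 5)) from this.imp_left hdih
    have sx := hS x (by simp)
    have sy := hS y (by simp)
    have sz := hS z (by simp)
    rcases le_total (Nat.card (stabilizer G x)) (Nat.card (stabilizer G y)) with c1 | c1 <;>
    rcases le_total (Nat.card (stabilizer G y)) (Nat.card (stabilizer G z)) with c2 | c2 <;>
    rcases le_total (Nat.card (stabilizer G x)) (Nat.card (stabilizer G z)) with c3 | c3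
    · exact three x y z hN sx c1 c2 hK'
    · exact three x y z hN sx c1 c2 hK'
    · exact three x z y hN sx c3 c2 (fun K hn => by rw [hK' K hn]; ring)
    · exact three z x y hN sz c3 c1 (fun K hn => by rw [hK' K hn]; ring)
    · exact three y x z hN sy c1 c3 (fun K hn => by rw [hK' K hn]; ring)
    · exact three y z x hN sy c2 c3 (fun K hn => by rw [hK' K hn]; ring)
    · exact three z y x hN sz c2 c1 (fun K hn => by rw [hK' K hn]; ring)
    · exact three z y x hN sz c2 c1 (fun K hn => by rw [hK' K hn]; ring)
end
end PGLAux
namespace PGLAux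
open Matrix MulAction

lemma sq_zero_of_tr_det (M : Matrix (Fin 2) (Fin 2) ℂ) (l : ℂ) (ht : M.trace = 2 * l)
    (hd : M.det = l ^ 2) : (M - l • 1) * (M - l • 1) = 0 := by
  rw [Matrix.trace_fin_two] at ht
  rw [Matrix.det_fin_two] at hd
  ext i j
  fin_cases i <;> fin_cases j <;> simp [Matrix.mul_apply, Fin.sum_univ_two]
  · linear_combination M 0 0 * ht - hd
  · linear_combination M 0 1 * ht
  · linear_combination M 1 0 * ht
  · linear_combination M 1 1 * ht - hd

lemma scalar_of_pow (M : Matrix (Fin 2) (Fin 2) ℂ) (l c : ℂ) (m : ℕ) (hm : m ≠ 0) (hl : l ≠ 0)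
    (ht : M.trace = 2 * l) (hd : M.det = l ^ 2) (hp : M ^ m = c • 1) : M = l • 1 := by
  set N := M - l • 1 with hN
  have hNN : N * N = 0 := sq_zero_of_tr_det M l ht hd
  have hM : M = l • 1 + N := by simp [hN]
  have hpow : ∀ k : ℕ, M ^ (k + 1) = l ^ (k + 1) • 1 + ((k + 1) * l ^ k) • N := by
    intro k
    induction k with
    | zero => simp [hM]
    | succ k ih =>
      rw [pow_succ, ih, hM]
      simp only [add_mul, mul_add, smul_mul_assoc, mul_smul_comm, one_mul, mul_one, hNN, smul_zero,
        add_zero]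
      push_cast
      module
  obtain ⟨k, rfl⟩ := Nat.exists_eq_succ_of_ne_zero hm
  have h1 := hpow k
  rw [Nat.succ_eq_add_one] at hp
  rw [hp] at h1
  have hne : ((k + 1) * l ^ k : ℂ) ≠ 0 := mul_ne_zero (by exact_mod_cast k.succ_ne_zero) (pow_ne_zero _ hl)
  have h2 : ((k + 1) * l ^ k : ℂ) • N = (c - l ^ (k + 1)) • 1 := by
    rw [sub_smul, h1]; abel
  have h3 : (c - l ^ (k + 1)) ^ 2 = 0 := by
    have : (((k + 1) * l ^ k : ℂ) • N) * (((k + 1) * l ^ k : ℂ) • N) = 0 := by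
      simp [hNN]
    rw [h2] at this
    have := congrFun (congrFun this 0) 0
    simp at this
    simp [this]
  have h4 : N = 0 := by
    rw [pow_eq_zero_iff two_ne_zero] at h3
    rw [h3, zero_smul] at h2
    exact (smul_eq_zero.1 h2).resolve_left hne
  rw [hM, h4, add_zero]

lemma prop_of_ker (N : Matrix (Fin 2) (Fin 2) ℂ) (hN : N ≠ 0) (u v : Fin 2 → ℂ) (hv : v ≠ 0)
    (h1 : N *ᵥ u = 0) (h2 : N *ᵥ v = 0) : ∃ k : ℂ, k • v = u := by
  have hD : u 0 * v 1 - u 1 * v 0 = 0 := by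
    by_contra hD
    apply hN
    ext i j
    have a1 := congrFun h1 i
    have a2 := congrFun h2 i
    simp [Matrix.mulVec, dotProduct, Fin.sum_univ_two] at a1 a2
    fin_cases j
    · apply (mul_eq_zero.1 (_ : N i 0 * (u 0 * v 1 - u 1 * v 0) = 0)).resolve_right hD
      linear_combination v 1 * a1 - u 1 * a2
    · apply (mul_eq_zero.1 (_ : N i 1 * (u 0 * v 1 - u 1 * v 0) = 0)).resolve_right hD
      linear_combination u 0 * a2 - v 0 * a1
  by_cases h0 : v 0 = 0
  · have h1 : v 1 ≠ 0 := by
      intro h1; apply hv; ext i; fin_cases i <;> simp [h0, h1]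
    refine ⟨u 1 / v 1, ?_⟩
    ext i
    fin_cases i
    · simp [h0] at hD ⊢
      tauto
    · simp [h1]
  · refine ⟨u 0 / v 0, ?_⟩
    ext i
    fin_cases i
    · simp [h0]
    · simp; field_simp; linear_combination hD

/-- `PGL(2, ℂ)` -/
abbrev PG := ProjGenLinGroup (Fin 2) ℂ
abbrev PX := Projectivization ℂ (Fin 2 → ℂ)

open ProjGenLinGroup

lemma coe_eq_of_mk (A B : GL (Fin 2) ℂ) (h : (mk A : PG) = mk B) :
    ∃ u : ℂ, u ≠ 0 ∧ (B : Matrix (Fin 2) (Fin 2) ℂ) = u • (A : Matrix (Fin 2) (Fin 2) ℂ) := by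
  obtain ⟨u, hu⟩ := mk_eq_mk_iff.1 h
  refine ⟨u, u.ne_zero, ?_⟩
  rw [← hu]
  ext i j
  simp [mul_comm]

lemma mk_one_of_scalar (A : GL (Fin 2) ℂ) (l : ℂ)
    (h : (A : Matrix (Fin 2) (Fin 2) ℂ) = l • 1) : (mk A : PG) = 1 := by
  rw [mk_eq_one, Subgroup.mem_center_iff]
  intro B
  ext1
  simp [h]

lemma det_ne (A : GL (Fin 2) ℂ) : (A : Matrix (Fin 2) (Fin 2) ℂ).det ≠ 0 :=
  ((Matrix.isUnit_iff_isUnit_det _).1 A.isUnit).ne_zero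

lemma triv_of_tr_det (A : GL (Fin 2) ℂ) (l : ℂ) (hfin : IsOfFinOrder (mk A : PG))
    (ht : (A : Matrix (Fin 2) (Fin 2) ℂ).trace = 2 * l)
    (hd : (A : Matrix (Fin 2) (Fin 2) ℂ).det = l ^ 2) : (mk A : PG) = 1 := by
  obtain ⟨m, hm, h⟩ := isOfFinOrder_iff_pow_eq_one.1 hfin
  have h1 : (mk 1 : PG) = mk (A ^ m) := by rw [map_pow, h, map_one]
  obtain ⟨u, -, hu⟩ := coe_eq_of_mk _ _ h1
  have hl : l ≠ 0 := by
    rintro rfl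
    exact det_ne A (by simpa using hd)
  exact mk_one_of_scalar A l (scalar_of_pow _ l u m hm.ne' hl ht hd (by simpa using hu))

lemma smul_fix (A : GL (Fin 2) ℂ) (v : Fin 2 → ℂ) (hv : v ≠ 0) :
    (mk A : PG) • (Projectivization.mk ℂ v hv : PX) = Projectivization.mk ℂ v hv ↔
      ∃ l : ℂ, (A : Matrix (Fin 2) (Fin 2) ℂ) *ᵥ v = l • v := by
  rw [Projectivization.PGL.mk_smul_mk, Projectivization.mk_eq_mk_iff']
  constructor
  · rintro ⟨a, ha⟩; exact ⟨a, ha.symm⟩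
  · rintro ⟨a, ha⟩; exact ⟨a, ha.symm⟩

lemma ev_ker (M : Matrix (Fin 2) (Fin 2) ℂ) (l : ℂ) (v : Fin 2 → ℂ) :
    M *ᵥ v = l • v ↔ (M - l • 1) *ᵥ v = 0 := by
  rw [Matrix.sub_mulVec, Matrix.smul_mulVec, Matrix.one_mulVec, sub_eq_zero]

lemma ev_det (M : Matrix (Fin 2) (Fin 2) ℂ) (l : ℂ) :
    (∃ v, v ≠ 0 ∧ M *ᵥ v = l • v) ↔ l ^ 2 - M.trace * l + M.det = 0 := by
  simp only [ev_ker]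
  rw [Matrix.exists_mulVec_eq_zero_iff, Matrix.trace_fin_two, Matrix.det_fin_two,
    Matrix.det_fin_two]
  simp
  constructor <;> intro h <;> linear_combination h

lemma two_fixed (g : PG) (hg : g ≠ 1) (hfin : IsOfFinOrder g) :
    ∃ p q : PX, p ≠ q ∧ ∀ x, g • x = x ↔ x = p ∨ x = q := by
  obtain ⟨A, rfl⟩ := mk_surjective g
  set M : Matrix (Fin 2) (Fin 2) ℂ := A.val with hM
  obtain ⟨s, hs⟩ := IsAlgClosed.exists_pow_nat_eq (M.trace ^ 2 - 4 * M.det) (n := 2) (by norm_num)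
  have hs0 : s ≠ 0 := by
    rintro rfl
    apply hg
    apply triv_of_tr_det A (M.trace / 2) hfin
    · rw [← hM]; ring
    · rw [← hM]; linear_combination (1 / 4 : ℂ) * hs
  obtain ⟨v, hv, hMv⟩ := (ev_det M ((M.trace + s) / 2)).2 (by linear_combination (1 / 4 : ℂ) * hs)
  obtain ⟨w, hw, hMw⟩ := (ev_det M ((M.trace - s) / 2)).2 (by linear_combination (1 / 4 : ℂ) * hs)
  have hns : ∀ l : ℂ, M - l • 1 ≠ 0 := by
    intro l h
    exact hg (mk_one_of_scalar A l (sub_eq_zero.1 h))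
  refine ⟨Projectivization.mk ℂ v hv, Projectivization.mk ℂ w hw, ?_, ?_⟩
  · intro h
    obtain ⟨a, rfl⟩ := (Projectivization.mk_eq_mk_iff' ℂ v w hv hw).1 h
    rw [Matrix.mulVec_smul, hMw, ← sub_eq_zero] at hMv
    have : s • (a • w) = 0 := by
      rw [← neg_eq_zero, ← hMv]
      module
    exact (smul_eq_zero.1 this).elim hs0 hv
  · intro x
    induction x using Projectivization.ind with | _ u hu =>
    rw [smul_fix, Projectivization.mk_eq_mk_iff', Projectivization.mk_eq_mk_iff']
    constructor
    · rintro ⟨l, hl⟩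
      have h1 := (ev_det M l).1 ⟨u, hu, hl⟩
      have h2 : (l - (M.trace + s) / 2) * (l - (M.trace - s) / 2) = 0 := by
        linear_combination h1 - (1 / 4 : ℂ) * hs
      rcases mul_eq_zero.1 h2 with h | h
      · rw [sub_eq_zero] at h
        subst h
        exact Or.inl (prop_of_ker _ (hns _) u v hv ((ev_ker _ _ _).1 hl) ((ev_ker _ _ _).1 hMv))
      · rw [sub_eq_zero] at h
        subst h
        exact Or.inr (prop_of_ker _ (hns _) u w hw ((ev_ker _ _ _).1 hl) ((ev_ker _ _ _).1 hMw))
    · rintro (⟨a, rfl⟩ | ⟨a, rfl⟩)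
      · exact ⟨_, by rw [← hM, Matrix.mulVec_smul, hMv, smul_comm]⟩
      · exact ⟨_, by rw [← hM, Matrix.mulVec_smul, hMw, smul_comm]⟩

lemma stab_cyclic (G : Subgroup PG) [Finite G] (x : PX) : IsCyclic (stabilizer G x) := by
  induction x using Projectivization.ind with | _ v hv =>
  set x : PX := Projectivization.mk ℂ v hv with hx
  have hex : ∀ g : stabilizer G x, ∃ c : ℂ, ∀ (A : GL (Fin 2) ℂ) (l : ℂ),
      (mk A : PG) = g.1.1 → (A : Matrix (Fin 2) (Fin 2) ℂ) *ᵥ v = l • v →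
      c * l ^ 2 = (A : Matrix (Fin 2) (Fin 2) ℂ).det := by
    intro g
    obtain ⟨A, hA⟩ := mk_surjective g.1.1
    have h1 : (mk A : PG) • x = x := by rw [hA]; exact g.2
    obtain ⟨l, hl⟩ := (smul_fix A v hv).1 h1
    have hl0 : l ≠ 0 := by
      rintro rfl
      have := (ev_det _ _).1 ⟨v, hv, hl⟩
      exact det_ne A (by simpa using this)
    refine ⟨(A : Matrix (Fin 2) (Fin 2) ℂ).det / l ^ 2, ?_⟩
    intro B m hB hm
    obtain ⟨u, hu0, hu⟩ := coe_eq_of_mk A B (hA.trans hB.symm)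
    have hml : m = u * l := by
      rw [hu, Matrix.smul_mulVec, hl, smul_smul, ← sub_eq_zero, ← sub_smul] at hm
      exact (sub_eq_zero.1 ((smul_eq_zero.1 hm).resolve_right hv)).symm
    rw [hu, hml, Matrix.det_smul]
    simp
    field_simp
  choose f hf using hex
  have lift : ∀ g : stabilizer G x, ∃ (A : GL (Fin 2) ℂ) (l : ℂ), l ≠ 0 ∧
      (mk A : PG) = g.1.1 ∧ (A : Matrix (Fin 2) (Fin 2) ℂ) *ᵥ v = l • v := by
    intro g
    obtain ⟨A, hA⟩ := mk_surjective g.1.1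
    have h1 : (mk A : PG) • x = x := by rw [hA]; exact g.2
    obtain ⟨l, hl⟩ := (smul_fix A v hv).1 h1
    refine ⟨A, l, ?_, hA, hl⟩
    rintro rfl
    have := (ev_det _ _).1 ⟨v, hv, hl⟩
    exact det_ne A (by simpa using this)
  let F : stabilizer G x →* ℂ :=
    { toFun := f
      map_one' := by
        have := hf 1 1 1 (by simp) (by simp)
        simpa using this
      map_mul' := by
        intro g h
        obtain ⟨A, l, hl0, hA, hl⟩ := lift g
        obtain ⟨B, m, hm0, hB, hm⟩ := lift h
        have e1 := hf g A l hA hl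
        have e2 := hf h B m hB hm
        have e3 := hf (g * h) (A * B) (l * m) (by rw [map_mul, hA, hB]; rfl) (by
          rw [Units.val_mul, ← Matrix.mulVec_mulVec, hm, Matrix.mulVec_smul, hl, smul_smul, mul_comm])
        rw [Units.val_mul, Matrix.det_mul, ← e1, ← e2] at e3
        have : l ^ 2 * m ^ 2 ≠ 0 := by positivity
        apply mul_right_cancel₀ this
        linear_combination e3 }
  apply isCyclic_of_injective_ringHom F
  rw [injective_iff_map_eq_one]
  intro g hg
  obtain ⟨A, l, hl0, hA, hl⟩ := lift g
  have e1 := hf g A l hA hl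
  have e0 : f g = 1 := hg
  rw [e0, one_mul] at e1
  have e2 := (ev_det _ _).1 ⟨v, hv, hl⟩
  have hfin : IsOfFinOrder (mk A : PG) := by
    rw [hA]
    exact G.subtype.isOfFinOrder (isOfFinOrder_of_finite g.1)
  have := triv_of_tr_det A l hfin (by
    apply mul_right_cancel₀ hl0
    linear_combination (-1 : ℂ) * e2 - e1) e1.symm
  ext1; ext1
  rw [← hA, this]; rfl

theorem main_PG (G : Subgroup PG) [Finite G] :
    IsCyclic G ∨
      (∃ n : ℕ, 0 < n ∧ Nonempty (G ≃* DihedralGroup n)) ∨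
      Nonempty (G ≃* alternatingGroup (Fin 4)) ∨
      Nonempty (G ≃* Equiv.Perm (Fin 4)) ∨
      Nonempty (G ≃* alternatingGroup (Fin 5)) := by
  refine abstract_main (X := PX) ?_ (stab_cyclic G)
  intro g hg
  exact two_fixed g.1 (fun h => hg (Subtype.ext h))
    (G.subtype.isOfFinOrder (isOfFinOrder_of_finite g))

end PGLAux

/-- Every finite subgroup of `PGL(2, ℂ)` is cyclic, dihedral, or isomorphic to `A₄`, `S₄`
or `A₅`. -/
theorem finite_subgroup_PGL2C_classification (G : Subgroup PGL2C) [Finite G] :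
    IsCyclic G ∨
      (∃ n : ℕ, 0 < n ∧ Nonempty (G ≃* DihedralGroup n)) ∨
      Nonempty (G ≃* alternatingGroup (Fin 4)) ∨
      Nonempty (G ≃* Equiv.Perm (Fin 4)) ∨
      Nonempty (G ≃* alternatingGroup (Fin 5)) := by
  exact @PGLAux.main_PG G ‹Finite G›
end

section
/- Let G and G' be finite subgroups of PGL(2,ℂ) that are isomorphic as abstract groups. Then G and G' are conjugate in PGL(2,ℂ): there exists x ∈ PGL(2,ℂ) such that G' = x G x⁻¹. -/
open Matrix


theorem num_lemma (n r1 r2 r3 d1 d2 d3 : ℕ) (h12 : r1 ≤ r2) (h23 : r2 ≤ r3) (hr : 2 ≤ r1)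
    (e1 : d1 * r1 = n) (e2 : d2 * r2 = n) (e3 : d3 * r3 = n)
    (hd : d1 + d2 + d3 = n + 2) : (r1 = 2 ∧ r2 = 2 ∧ 2 * r3 = n) ∨
    (n = 12 ∧ r1 = 2 ∧ r2 = 3 ∧ r3 = 3) ∨ (n = 24 ∧ r1 = 2 ∧ r2 = 3 ∧ r3 = 4) ∨
    (n = 60 ∧ r1 = 2 ∧ r2 = 3 ∧ r3 = 5) := by
  have a1 : r1 < 3 := by
    by_contra h
    have := Nat.mul_le_mul_left d1 (show 3 ≤ r1 by omega)
    have := Nat.mul_le_mul_left d2 (show 3 ≤ r2 by omega)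
    have := Nat.mul_le_mul_left d3 (show 3 ≤ r3 by omega)
    omega
  obtain rfl : r1 = 2 := by omega
  have a2 : r2 < 4 := by
    by_contra h
    have := Nat.mul_le_mul_left d2 (show 4 ≤ r2 by omega)
    have := Nat.mul_le_mul_left d3 (show 4 ≤ r3 by omega)
    omega
  have : r2 = 2 ∨ r2 = 3 := by omega
  rcases this with rfl | rfl
  · left
    have : d3 = 2 := by omega
    subst this
    exact ⟨rfl, rfl, e3⟩
  · right
    have a3 : r3 < 6 := by
      by_contra h
      have := Nat.mul_le_mul_left d3 (show 6 ≤ r3 by omega)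
      omega
    interval_cases r3 <;> omega

theorem count_lemma {G X : Type*} [Group G] [Finite G] [MulAction G X] [Finite X] [Nontrivial G]
    (h2 : ∀ g : G, g ≠ 1 → Nat.card (MulAction.fixedBy X g) = 2)
    (hs : ∀ x : X, ∃ g : G, g ≠ 1 ∧ g • x = x)
    (hc : ∀ x : X, IsCyclic (MulAction.stabilizer G x)) :
    IsCyclic G ∨
    (∃ c : G, 2 * orderOf c = Nat.card G ∧ 2 ≤ orderOf c ∧
      ∀ g, g ∉ Subgroup.zpowers c → orderOf g = 2) ∨
    (Nat.card G = 12 ∧ ∀ g : G, g ≠ 1 → orderOf g = 2 ∨ orderOf g = 3) ∨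
    (Nat.card G = 24 ∧ (∃ c : G, orderOf c = 4) ∧
      ∀ g : G, g ≠ 1 → orderOf g = 2 ∨ orderOf g = 3 ∨ orderOf g = 4) ∨
    (Nat.card G = 60 ∧ ∀ g : G, g ≠ 1 → orderOf g = 2 ∨ orderOf g = 3 ∨ orderOf g = 5) := by
  classical
  have := Fintype.ofFinite G
  have := Fintype.ofFinite X
  let Ω := Quotient (MulAction.orbitRel G X)
  let r : Ω → ℕ := fun w => Nat.card (MulAction.stabilizer G w.out)
  let d : Ω → ℕ := fun w => Nat.card G / r w
  have hdr : ∀ w, d w * r w = Nat.card G := fun w =>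
    Nat.div_mul_cancel (Subgroup.card_subgroup_dvd_card _)
  have hr2 : ∀ w, 2 ≤ r w := by
    intro w
    obtain ⟨g, hg, hx⟩ := hs w.out
    have : Nontrivial (MulAction.stabilizer G w.out) :=
      ⟨⟨⟨g, hx⟩, 1, fun h => hg (congrArg Subtype.val h)⟩⟩
    exact Finite.one_lt_card
  have hdp : ∀ w, 1 ≤ d w := by
    intro w
    rcases Nat.eq_zero_or_pos (d w) with h | h
    · have := hdr w
      rw [h] at this
      have := Nat.card_pos (α := G)
      omega
    · exact h
  have hn : 2 ≤ Nat.card G := Finite.one_lt_card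
  have hX : Nat.card X = ∑ w, d w := by
    rw [Nat.card_eq_fintype_card, MulAction.card_eq_sum_card_group_div_card_stabilizer G X]
    simp only [d, r, Nat.card_eq_fintype_card]
    rfl
  have hB : Nat.card X + 2 * (Nat.card G - 1) = Fintype.card Ω * Nat.card G := by
    have := MulAction.sum_card_fixedBy_eq_card_orbits_mul_card_group G X
    rw [← Finset.add_sum_erase _ _ (Finset.mem_univ (1:G))] at this
    rw [Finset.sum_congr rfl (g := fun _ => 2)] at this
    · simp only [Nat.card_eq_fintype_card]
      rw [← this]
      simp [mul_comm]
    · intro g hg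
      rw [← h2 g (by simpa using hg), Nat.card_eq_fintype_card]
  have hk1 : Fintype.card Ω * 1 ≤ ∑ w, d w := by
    rw [← smul_eq_mul, ← Finset.card_univ]
    exact Finset.card_nsmul_le_sum _ _ _ (fun w _ => hdp w)
  have hk2 : 2 * ∑ w, d w ≤ Fintype.card Ω * Nat.card G := by
    rw [Finset.mul_sum, ← smul_eq_mul, ← Finset.card_univ]
    refine Finset.sum_le_card_nsmul _ _ _ (fun w _ => ?_)
    rw [← hdr w, mul_comm]
    exact Nat.mul_le_mul_left _ (hr2 w)
  rw [hX] at hB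
  have k4 : Fintype.card Ω < 4 := by
    by_contra h
    have := Nat.mul_le_mul_right (Nat.card G) (show 4 ≤ Fintype.card Ω by omega)
    omega
  -- stabilizers
  have hst : ∀ x : X, ∃ g : G, MulAction.stabilizer G x =
      (MulAction.stabilizer G (Quotient.mk (MulAction.orbitRel G X) x).out).map
        (MulAut.conj g).toMonoidHom := by
    intro x
    have : x ∈ MulAction.orbit G (Quotient.mk (MulAction.orbitRel G X) x).out :=
      MulAction.orbitRel_apply.1 (Setoid.symm' (MulAction.orbitRel G X) (@Quotient.mk_out _ (MulAction.orbitRel G X) x))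
    obtain ⟨g, hg⟩ := this
    exact ⟨g, by rw [← MulAction.stabilizer_smul_eq_stabilizer_map_conj]; exact congrArg _ hg.symm⟩
  have hord : ∀ g : G, g ≠ 1 → ∃ x : X, g ∈ MulAction.stabilizer G x := by
    intro g hg
    have : Nonempty (MulAction.fixedBy X g) := by
      by_contra h
      rw [not_nonempty_iff] at h
      have := h2 g hg
      simp at this
    obtain ⟨x, hx⟩ := this
    exact ⟨x, hx⟩
  have hord' : ∀ g : G, g ≠ 1 → ∃ w : Ω, orderOf g ∣ r w := by
    intro g hg
    obtain ⟨x, hx⟩ := hord g hg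
    refine ⟨Quotient.mk _ x, ?_⟩
    obtain ⟨k, hk⟩ := hst x
    have h1 : orderOf g ∣ Nat.card (MulAction.stabilizer G x) :=
      Subgroup.orderOf_dvd_natCard _ hx
    rw [hk, Subgroup.card_map_of_injective (MulAut.conj k).injective] at h1
    exact h1
  have hgen : ∀ w : Ω, ∃ c : G, orderOf c = r w ∧
      Subgroup.zpowers c = MulAction.stabilizer G w.out := by
    intro w
    have := (MulAction.stabilizer G w.out).isCyclic_iff_exists_zpowers_eq_top.1 (hc w.out)
    obtain ⟨c, hc⟩ := this
    refine ⟨c, ?_, hc⟩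
    rw [← Nat.card_zpowers, hc]
  have hone : ∀ w : Ω, d w = 1 → IsCyclic G := by
    intro w hw
    obtain ⟨c, h1, h2⟩ := hgen w
    have := hdr w
    rw [hw, one_mul] at this
    exact isCyclic_of_orderOf_eq_card c (by rw [h1, this])
  have hko : ∀ g : G, g ≠ 1 → orderOf g ≠ 1 := fun g hg h => hg (orderOf_eq_one_iff.1 h)
  have key : ∀ x y z : Ω, x ≠ y → x ≠ z → y ≠ z → (Finset.univ : Finset Ω) = {x, y, z} →
      r x ≤ r y → r y ≤ r z → d x + d y + d z = Nat.card G + 2 →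
    (∃ c : G, 2 * orderOf c = Nat.card G ∧ 2 ≤ orderOf c ∧
      ∀ g, g ∉ Subgroup.zpowers c → orderOf g = 2) ∨
    (Nat.card G = 12 ∧ ∀ g : G, g ≠ 1 → orderOf g = 2 ∨ orderOf g = 3) ∨
    (Nat.card G = 24 ∧ (∃ c : G, orderOf c = 4) ∧
      ∀ g : G, g ≠ 1 → orderOf g = 2 ∨ orderOf g = 3 ∨ orderOf g = 4) ∨
    (Nat.card G = 60 ∧ ∀ g : G, g ≠ 1 → orderOf g = 2 ∨ orderOf g = 3 ∨ orderOf g = 5) := by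
    intro x y z hxy hxz hyz hu h1 h2 hd
    have hall : ∀ w : Ω, w = x ∨ w = y ∨ w = z := by
      intro w
      have := Finset.mem_univ w
      rw [hu] at this
      simpa using this
    have dv2 : ∀ m : ℕ, m ∣ 2 → m ≠ 1 → m = 2 := fun m hm h =>
      ((Nat.dvd_prime Nat.prime_two).1 hm).resolve_left h
    have dv3 : ∀ m : ℕ, m ∣ 3 → m ≠ 1 → m = 3 := fun m hm h =>
      ((Nat.dvd_prime Nat.prime_three).1 hm).resolve_left h
    have dv5 : ∀ m : ℕ, m ∣ 5 → m ≠ 1 → m = 5 := fun m hm h =>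
      ((Nat.dvd_prime Nat.prime_five).1 hm).resolve_left h
    have dv4 : ∀ m : ℕ, m ∣ 4 → m ≠ 1 → m = 2 ∨ m = 4 := fun m hm h => by
      have := Nat.le_of_dvd (by norm_num) hm
      interval_cases m <;> omega
    rcases num_lemma _ _ _ _ _ _ _ h1 h2 (hr2 x) (hdr x) (hdr y) (hdr z) hd with
      ⟨a, b, c⟩ | ⟨a, b, c, e⟩ | ⟨a, b, c, e⟩ | ⟨a, b, c, e⟩
    · left
      obtain ⟨t, ht, ht'⟩ := hgen z
      refine ⟨t, by rw [ht, c], by rw [ht]; exact hr2 z, ?_⟩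
      intro g hg
      have hg1 : g ≠ 1 := fun h => hg (h ▸ one_mem _)
      obtain ⟨q, hq⟩ := hord g hg1
      obtain ⟨k, hk⟩ := hst q
      have hi : (Subgroup.zpowers t).index = 2 := by
        have := Subgroup.card_mul_index (Subgroup.zpowers t)
        rw [Nat.card_zpowers, ht, ← c, mul_comm] at this
        exact Nat.eq_of_mul_eq_mul_right (by have := hr2 z; omega) this
      have hnorm : (Subgroup.zpowers t).Normal := Subgroup.normal_of_index_eq_two hi
      have hq' : orderOf g ∣ r (Quotient.mk _ q) := by
        have h1 : orderOf g ∣ Nat.card (MulAction.stabilizer G q) :=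
          Subgroup.orderOf_dvd_natCard _ hq
        rw [hk, Subgroup.card_map_of_injective (MulAut.conj k).injective] at h1
        exact h1
      rcases hall (Quotient.mk _ q) with h | h | h
      · rw [h, a] at hq'
        exact dv2 _ hq' (hko g hg1)
      · rw [h, b] at hq'
        exact dv2 _ hq' (hko g hg1)
      · exfalso
        rw [hk, h, ← ht'] at hq
        obtain ⟨s, hs, rfl⟩ := hq
        exact hg (hnorm.conj_mem s hs k)
    · right; left
      refine ⟨a, fun g hg => ?_⟩
      obtain ⟨w, hw⟩ := hord' g hg
      rcases hall w with rfl | rfl | rfl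
      · rw [b] at hw; exact Or.inl (dv2 _ hw (hko g hg))
      · rw [c] at hw; exact Or.inr (dv3 _ hw (hko g hg))
      · rw [e] at hw; exact Or.inr (dv3 _ hw (hko g hg))
    · right; right; left
      refine ⟨a, ?_, fun g hg => ?_⟩
      · obtain ⟨t, ht, -⟩ := hgen z
        exact ⟨t, by rw [ht, e]⟩
      obtain ⟨w, hw⟩ := hord' g hg
      rcases hall w with rfl | rfl | rfl
      · rw [b] at hw; exact Or.inl (dv2 _ hw (hko g hg))
      · rw [c] at hw; exact Or.inr (Or.inl (dv3 _ hw (hko g hg)))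
      · rw [e] at hw
        have := dv4 _ hw (hko g hg)
        tauto
    · right; right; right
      refine ⟨a, fun g hg => ?_⟩
      obtain ⟨w, hw⟩ := hord' g hg
      rcases hall w with rfl | rfl | rfl
      · rw [b] at hw; exact Or.inl (dv2 _ hw (hko g hg))
      · rw [c] at hw; exact Or.inr (Or.inl (dv3 _ hw (hko g hg)))
      · rw [e] at hw; exact Or.inr (Or.inr (dv5 _ hw (hko g hg)))
  have hcases : Fintype.card Ω = 0 ∨ Fintype.card Ω = 1 ∨ Fintype.card Ω = 2 ∨
    Fintype.card Ω = 3 := by omega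
  rcases hcases with h | h | h | h
  · rw [h] at hB; omega
  · rw [h] at hB hk1; omega
  · left
    rw [h] at hB
    obtain ⟨x, y, hxy, hu⟩ := Finset.card_eq_two.1 (Finset.card_univ.trans h)
    rw [hu, Finset.sum_pair hxy] at hB
    refine hone x ?_
    have := hdp x
    have := hdp y
    omega
  · right
    rw [h] at hB
    obtain ⟨x, y, z, hxy, hxz, hyz, hu⟩ := Finset.card_eq_three.1 (Finset.card_univ.trans h)
    have hsum : d x + d y + d z = Nat.card G + 2 := by
      have : ∑ w, d w = d x + d y + d z := by
        rw [hu, Finset.sum_insert (by simp [hxy, hxz]), Finset.sum_pair hyz, add_assoc]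
      omega
    have hmem : ∀ w, w = x ∨ w = y ∨ w = z := by
      intro w
      have := Finset.mem_univ w
      rw [hu] at this
      simpa using this
    have pm : ∀ a b c : Ω, (∀ w, w = x ∨ w = y ∨ w = z → w = a ∨ w = b ∨ w = c) →
        (Finset.univ : Finset Ω) = {a, b, c} := by
      intro a b c h
      ext w
      simpa using h w (hmem w)
    rcases le_total (r x) (r y) with h1 | h1 <;> rcases le_total (r y) (r z) with h2 | h2 <;>
      rcases le_total (r x) (r z) with h3 | h3
    · exact key x y z hxy hxz hyz hu h1 h2 hsum
    · exact key x y z hxy hxz hyz hu h1 h2 hsum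
    · exact key x z y hxz hxy hyz.symm (pm _ _ _ (by tauto)) h3 h2 (by omega)
    · exact key z x y hxz.symm hyz.symm hxy (pm _ _ _ (by tauto)) h3 h1 (by omega)
    · exact key y x z hxy.symm hyz hxz (pm _ _ _ (by tauto)) h1 h3 (by omega)
    · exact key y z x hyz hxy.symm hxz.symm (pm _ _ _ (by tauto)) h2 h3 (by omega)
    · exact key z y x hyz.symm hxz.symm hxy.symm (pm _ _ _ (by tauto)) h2 h1 (by omega)
    · exact key z y x hyz.symm hxz.symm hxy.symm (pm _ _ _ (by tauto)) h2 h1 (by omega)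

abbrev M2 : Type := Matrix (Fin 2) (Fin 2) ℂ

/-- The matrix `M` represents `g`. -/
def Rp (M : M2) (g : PGL2C) : Prop :=
  ∃ A : GL (Fin 2) ℂ, (A : M2) = M ∧ (QuotientGroup.mk A : PGL2C) = g

theorem Rp.mul {M N : M2} {g h : PGL2C} (hM : Rp M g) (hN : Rp N h) : Rp (M * N) (g * h) := by
  obtain ⟨A, rfl, rfl⟩ := hM
  obtain ⟨B, rfl, rfl⟩ := hN
  exact ⟨A * B, rfl, rfl⟩

theorem Rp.pow {M : M2} {g : PGL2C} (hM : Rp M g) (k : ℕ) : Rp (M ^ k) (g ^ k) := by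
  obtain ⟨A, rfl, rfl⟩ := hM
  exact ⟨A ^ k, by simp, rfl⟩

theorem Rp.det_ne {M : M2} {g : PGL2C} (hM : Rp M g) : M.det ≠ 0 := by
  obtain ⟨A, rfl, rfl⟩ := hM
  exact A.det_ne_zero

theorem Rp.of_det {M : M2} (h : M.det ≠ 0) : ∃ g, Rp M g :=
  ⟨_, GeneralLinearGroup.mkOfDetNeZero M h, rfl, rfl⟩

theorem Rp.ex (g : PGL2C) : ∃ M, Rp M g := by
  obtain ⟨A, rfl⟩ := QuotientGroup.mk_surjective g
  exact ⟨_, A, rfl, rfl⟩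

theorem rp_one_iff {M : M2} {g : PGL2C} (h : Rp M g) : g = 1 ↔ ∃ c : ℂ, M = c • (1 : M2) := by
  obtain ⟨A, rfl, rfl⟩ := h
  rw [QuotientGroup.eq_one_iff, GeneralLinearGroup.mem_center_iff_val_mem_range_scalar]
  constructor
  · rintro ⟨c, hc⟩
    exact ⟨c, by rw [← hc, smul_one_eq_diagonal]; rfl⟩
  · rintro ⟨c, hc⟩
    exact ⟨c, by rw [hc, smul_one_eq_diagonal]; rfl⟩

theorem Rp.smul {M : M2} {g : PGL2C} (hM : Rp M g) {c : ℂ} (hc : c ≠ 0) : Rp (c • M) g := by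
  obtain ⟨k, hk⟩ := Rp.of_det (M := c • (1 : M2)) (by simp [hc])
  have : k = 1 := (rp_one_iff hk).2 ⟨c, rfl⟩
  subst this
  simpa using hk.mul hM

theorem Rp.adj {M : M2} {g : PGL2C} (hM : Rp M g) : Rp M.adjugate g⁻¹ := by
  obtain ⟨k, hk⟩ := Rp.of_det (M := M.adjugate) (by
    rw [det_adjugate]; simpa using hM.det_ne)
  have h1 := hM.mul hk
  rw [mul_adjugate] at h1
  have := (rp_one_iff h1).2 ⟨_, rfl⟩
  rw [eq_inv_of_mul_eq_one_right this] at hk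
  exact hk

theorem Rp.unique {M : M2} {g h : PGL2C} (hM : Rp M g) (hN : Rp M h) : g = h := by
  have := hM.mul hN.adj
  rw [mul_adjugate] at this
  exact mul_inv_eq_one.1 ((rp_one_iff this).2 ⟨_, rfl⟩)

theorem Rp.prop {M N : M2} {g : PGL2C} (hM : Rp M g) (hN : Rp N g) :
    ∃ c : ℂ, c ≠ 0 ∧ N = c • M := by
  obtain ⟨A, rfl, rfl⟩ := hM
  obtain ⟨B, rfl, hB⟩ := hN
  have h1 : Rp ((A⁻¹ * B : GL (Fin 2) ℂ) : M2) 1 := ⟨A⁻¹ * B, rfl, by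
    rw [QuotientGroup.mk_mul, hB, QuotientGroup.mk_inv, inv_mul_cancel]⟩
  obtain ⟨c, hc⟩ := (rp_one_iff h1).1 rfl
  refine ⟨c, ?_, ?_⟩
  · rintro rfl
    have := h1.det_ne
    rw [hc] at this
    simp at this
  · have : ((A * (A⁻¹ * B) : GL (Fin 2) ℂ) : M2) = c • (A : M2) := by
      rw [GeneralLinearGroup.coe_mul, hc]; simp
    simpa using this

theorem Rp.exdet (g : PGL2C) : ∃ M, M.det = 1 ∧ Rp M g := by
  obtain ⟨M, hM⟩ := Rp.ex g
  obtain ⟨s, hs⟩ := IsAlgClosed.exists_pow_nat_eq (M.det)⁻¹ (n := 2) (by norm_num)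
  have hd := hM.det_ne
  have hs0 : s ≠ 0 := by
    rintro rfl
    have := inv_ne_zero hd
    simp at hs
    exact hd hs.symm
  refine ⟨s • M, ?_, hM.smul hs0⟩
  rw [det_smul]
  simp [hs, hd]

/-- conjugating relation -/
theorem Rp.conj {M N P : M2} {g x : PGL2C} (hM : Rp M g) (hP : Rp P x) (h : M * P = P * N) :
    Rp N (x⁻¹ * g * x) := by
  obtain ⟨k, hk⟩ := Rp.of_det (M := N) (by
    have h1 := congrArg det h
    rw [det_mul, det_mul] at h1
    intro h0
    rw [h0, mul_zero] at h1
    exact mul_ne_zero hM.det_ne hP.det_ne h1)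
  have h1 := hM.mul hP
  rw [h] at h1
  have := h1.unique (hP.mul hk)
  rw [mul_assoc, this, inv_mul_cancel_left]
  exact hk

theorem unip {a b : ℂ} {g : PGL2C} (h : Rp !![a, b; 0, a] g) {k : ℕ} (hk : k ≠ 0)
    (hg : g ^ k = 1) : g = 1 := by
  have hp : ∀ n : ℕ, (!![a, b; 0, a] : M2) ^ (n + 1) = !![a ^ (n+1), (n + 1) * a ^ n * b; 0, a ^ (n+1)] := by
    intro n
    induction n with
    | zero => simp
    | succ n ih =>
      rw [pow_succ, ih]
      ext i j
      fin_cases i <;> fin_cases j <;> simp [Matrix.mul_apply] <;> ring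
  obtain ⟨n, rfl⟩ := Nat.exists_eq_succ_of_ne_zero hk
  obtain ⟨c, hc⟩ := (rp_one_iff (h.pow _)).1 hg
  rw [Nat.succ_eq_add_one, hp] at hc
  have h01 := congrFun (congrFun hc 0) 1
  have ha : a ≠ 0 := by
    have := h.det_ne
    simpa [det_fin_two] using this
  have hn : (n : ℂ) + 1 ≠ 0 := by exact_mod_cast Nat.succ_ne_zero n
  have hb : b = 0 := by simpa [hn, ha] using h01
  refine (rp_one_iff h).2 ⟨a, ?_⟩
  rw [hb]
  ext i j
  fin_cases i <;> fin_cases j <;> simp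

/-- action on the projective line -/
noncomputable def act : PGL2C →* Equiv.Perm (OnePoint ℂ) :=
  QuotientGroup.lift _ (MulAction.toPermHom (GL (Fin 2) ℂ) (OnePoint ℂ)) (by
    intro g hg
    obtain ⟨c, hc⟩ := GeneralLinearGroup.mem_center_iff_val_mem_range_scalar.1 hg
    have hd := g.det_ne_zero
    rw [← hc] at hd
    have hc0 : c ≠ 0 := by
      rintro rfl
      simp at hd
    ext x
    cases x with
    | infty => simp [OnePoint.smul_infty_eq_ite, ← hc]
    | coe z => simp [OnePoint.smul_some_eq_ite, ← hc, hc0])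

theorem act_mk (A : GL (Fin 2) ℂ) (p : OnePoint ℂ) : act (QuotientGroup.mk A) p = A • p := rfl

theorem act_infty {M : M2} {g : PGL2C} (h : Rp M g) :
    act g OnePoint.infty = OnePoint.infty ↔ M 1 0 = 0 := by
  obtain ⟨A, rfl, rfl⟩ := h
  rw [act_mk, OnePoint.smul_infty_eq_self_iff]

theorem act_trans (p : OnePoint ℂ) : ∃ x, act x OnePoint.infty = p := by
  cases p with
  | infty => exact ⟨1, by simp⟩
  | coe z =>
    refine ⟨QuotientGroup.mk (GeneralLinearGroup.mkOfDetNeZero !![z, 1; 1, 0] (by simp [det_fin_two])), ?_⟩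
    rw [act_mk, OnePoint.smul_infty_eq_ite]
    simp [GeneralLinearGroup.mkOfDetNeZero]

theorem act_fix (g : PGL2C) : ∃ p, act g p = p := by
  obtain ⟨A, rfl⟩ := QuotientGroup.mk_surjective g
  by_cases hc : A 1 0 = 0
  · exact ⟨OnePoint.infty, by rw [act_mk, OnePoint.smul_infty_eq_self_iff, hc]⟩
  · obtain ⟨s, hs⟩ := IsAlgClosed.exists_pow_nat_eq
      ((A 0 0 - A 1 1) ^ 2 + 4 * A 0 1 * A 1 0) (n := 2) (by norm_num)
    refine ⟨(((A 0 0 - A 1 1 + s) / (2 * A 1 0) : ℂ) : OnePoint ℂ), ?_⟩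
    rw [act_mk, ← GeneralLinearGroup.fixpointPolynomial_aeval_eq_zero_iff]
    simp [GeneralLinearGroup.fixpointPolynomial]
    field_simp
    linear_combination hs

theorem fix_conj (g x : PGL2C) (p : OnePoint ℂ) :
    act (x⁻¹ * g * x) p = p ↔ act g (act x p) = act x p := by
  simp only [map_mul, Equiv.Perm.mul_apply, map_inv]
  rw [Equiv.Perm.inv_eq_iff_eq]

theorem upper_of_fix {g x : PGL2C} (h : act g (act x OnePoint.infty) = act x OnePoint.infty) :
    ∃ a b d : ℂ, a ≠ 0 ∧ d ≠ 0 ∧ Rp !![a, b; 0, d] (x⁻¹ * g * x) := by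
  rw [← fix_conj] at h
  obtain ⟨M, hM⟩ := Rp.ex (x⁻¹ * g * x)
  rw [act_infty hM] at h
  have hMe : M = !![M 0 0, M 0 1; 0, M 1 1] := by
    ext i j
    fin_cases i <;> fin_cases j <;> simp [h]
  rw [hMe] at hM
  have := hM.det_ne
  simp [det_fin_two] at this
  exact ⟨_, _, _, this.1, this.2, hM⟩

theorem diag_form {g : PGL2C} (hg : g ≠ 1) (hf : IsOfFinOrder g) :
    ∃ (x : PGL2C) (ζ : ℂ), ζ ≠ 1 ∧ Rp !![ζ, 0; 0, 1] (x⁻¹ * g * x) := by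
  obtain ⟨p, hp⟩ := act_fix g
  obtain ⟨x, rfl⟩ := act_trans p
  obtain ⟨a, b, d, ha, hd, hM⟩ := upper_of_fix hp
  obtain ⟨k, hk, hk1⟩ := isOfFinOrder_iff_pow_eq_one.1 hf
  have hcp : (x⁻¹ * g * x) ^ k = 1 := by
    have := conj_pow (i := k) (a := x⁻¹) (b := g)
    rw [inv_inv] at this
    rw [this, hk1]; simp
  have had : a ≠ d := by
    rintro rfl
    have := unip hM hk.ne' hcp
    apply hg
    rw [mul_assoc, inv_mul_eq_one] at this
    simpa using this
  have hda : d - a ≠ 0 := sub_ne_zero.2 had.symm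
  obtain ⟨u, hu⟩ := Rp.of_det (M := !![1, b / (d - a); 0, 1]) (by simp [det_fin_two])
  refine ⟨x * u, a / d, by rw [Ne, div_eq_one_iff_eq hd]; exact had, ?_⟩
  have h3 := hM.conj hu (N := !![a, 0; 0, d]) (by
    ext i j
    fin_cases i <;> fin_cases j <;> simp [Matrix.mul_apply] 
    field_simp
    ring)
  have h4 := h3.smul (inv_ne_zero hd)
  have e : (d⁻¹ • !![a, 0; 0, d] : M2) = !![a / d, 0; 0, 1] := by
    ext i j
    fin_cases i <;> fin_cases j <;> simp [hd, div_eq_inv_mul]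
  rw [e] at h4
  convert h4 using 1
  group

theorem diag_fix {g : PGL2C} {ζ : ℂ} (hz : ζ ≠ 1) (h : Rp !![ζ, 0; 0, 1] g) (p : OnePoint ℂ) :
    act g p = p ↔ p = OnePoint.infty ∨ p = ((0 : ℂ) : OnePoint ℂ) := by
  cases p with
  | infty => simp [act_infty h]
  | coe z =>
    obtain ⟨A, hA, rfl⟩ := h
    rw [act_mk, OnePoint.smul_some_eq_ite]
    have h1 : A 0 0 = ζ := by rw [hA]; rfl
    have h2 : A 0 1 = 0 := by rw [hA]; rfl
    have h3 : A 1 0 = 0 := by rw [hA]; rfl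
    have h4 : A 1 1 = 1 := by rw [hA]; rfl
    simp only [h1, h2, h3, h4]
    simp [OnePoint.coe_eq_coe]
    constructor
    · intro h
      by_contra h0
      exact hz (mul_right_cancel₀ h0 (by rw [h, one_mul]))
    · rintro rfl; simp

theorem fix_two {g : PGL2C} (hg : g ≠ 1) (hf : IsOfFinOrder g) :
    ∃ p q : OnePoint ℂ, p ≠ q ∧ ∀ r, act g r = r ↔ r = p ∨ r = q := by
  obtain ⟨x, ζ, hz, h⟩ := diag_form hg hf
  refine ⟨act x OnePoint.infty, act x ((0 : ℂ) : OnePoint ℂ), by simp, fun r => ?_⟩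
  obtain ⟨s, rfl⟩ := (act x).surjective r
  rw [← fix_conj, diag_fix hz h]
  simp

/-- multiplier -/
noncomputable def mu (g : PGL2C) : ℂ := (Rp.ex g).choose 0 0 / (Rp.ex g).choose 1 1

theorem mu_eq {g : PGL2C} {M : M2} (h : Rp M g) : mu g = M 0 0 / M 1 1 := by
  obtain ⟨c, hc, e⟩ := h.prop (Rp.ex g).choose_spec
  rw [mu, e]
  simp [mul_div_mul_left _ _ hc]

theorem stab_cyclic (S : Subgroup PGL2C) [Finite S] (p : OnePoint ℂ) (h : ∀ g ∈ S, act g p = p) :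
    IsCyclic S := by
  obtain ⟨x, rfl⟩ := act_trans p
  let f : S →* ℂ :=
    { toFun := fun s => mu (x⁻¹ * s * x)
      map_one' := by
        have : Rp (1 : M2) 1 := ⟨1, rfl, rfl⟩
        simp only [OneMemClass.coe_one, mul_one, inv_mul_cancel]
        rw [mu_eq this]
        simp
      map_mul' := by
        rintro ⟨s, hs⟩ ⟨t, ht⟩
        obtain ⟨a, b, d, ha, hd, hM⟩ := upper_of_fix (h s hs)
        obtain ⟨a', b', d', ha', hd', hM'⟩ := upper_of_fix (h t ht)
        have h2 := hM.mul hM'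
        have e : x⁻¹ * s * x * (x⁻¹ * t * x) = x⁻¹ * (s * t) * x := by group
        rw [e] at h2
        simp only [Subgroup.coe_mul, MulMemClass.mk_mul_mk]
        rw [mu_eq hM, mu_eq hM', mu_eq h2]
        simp [Matrix.mul_apply, div_mul_div_comm] }
  refine isCyclic_of_injective_ringHom f ((injective_iff_map_eq_one' f).2 ?_ )
  rintro ⟨s, hs⟩
  constructor
  · intro h1
    obtain ⟨a, b, d, ha, hd, hM⟩ := upper_of_fix (h s hs)
    have h1' : mu (x⁻¹ * s * x) = 1 := h1
    rw [mu_eq hM] at h1'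
    simp [div_eq_one_iff_eq hd] at h1'
    subst h1'
    have hp : s ^ Nat.card S = 1 := by
      have := pow_card_eq_one' (x := (⟨s, hs⟩ : S))
      exact congrArg Subtype.val this
    have hcp : (x⁻¹ * s * x) ^ Nat.card S = 1 := by
      have := conj_pow (i := Nat.card S) (a := x⁻¹) (b := s)
      rw [inv_inv] at this
      rw [this, hp]; simp
    have := unip hM Nat.card_pos.ne' hcp
    ext
    simp only [OneMemClass.coe_one]
    rw [mul_assoc, inv_mul_eq_one] at this
    simpa using this
  · intro h1
    rw [h1]; exact map_one f

theorem classify (G : Subgroup PGL2C) [Finite G] :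
    IsCyclic G ∨
    (∃ c : G, 2 * orderOf c = Nat.card G ∧ 2 ≤ orderOf c ∧
      ∀ g, g ∉ Subgroup.zpowers c → orderOf g = 2) ∨
    (Nat.card G = 12 ∧ ∀ g : G, g ≠ 1 → orderOf g = 2 ∨ orderOf g = 3) ∨
    (Nat.card G = 24 ∧ (∃ c : G, orderOf c = 4) ∧
      ∀ g : G, g ≠ 1 → orderOf g = 2 ∨ orderOf g = 3 ∨ orderOf g = 4) ∨
    (Nat.card G = 60 ∧ ∀ g : G, g ≠ 1 → orderOf g = 2 ∨ orderOf g = 3 ∨ orderOf g = 5) := by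
  rcases subsingleton_or_nontrivial G with hs | hn
  · left; infer_instance
  have hfin : ∀ g : G, IsOfFinOrder (g : PGL2C) := fun g =>
    G.subtype.isOfFinOrder (isOfFinOrder_of_finite g)
  letI : MulAction G (OnePoint ℂ) := MulAction.compHom (OnePoint ℂ) (act.comp G.subtype)
  have hsm : ∀ (g : G) (p : OnePoint ℂ), g • p = act g p := fun _ _ => rfl
  let X : SubMulAction G (OnePoint ℂ) :=
    { carrier := {p | ∃ g : G, g ≠ 1 ∧ g • p = p}
      smul_mem' := by
        rintro h p ⟨g, hg, hp⟩
        refine ⟨h * g * h⁻¹, ?_, ?_⟩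
        · intro h1
          exact hg (conj_eq_one_iff.1 h1)
        · rw [mul_smul, inv_smul_smul, mul_smul, hp] }
  have hfix : ∀ g : G, g ≠ 1 → ∃ p q : OnePoint ℂ, p ≠ q ∧ ∀ r, g • r = r ↔ r = p ∨ r = q := by
    intro g hg
    exact fix_two (by simpa using hg) (hfin g)
  have hXf : (X : Set (OnePoint ℂ)).Finite := by
    have : (X : Set (OnePoint ℂ)) = ⋃ g : {g : G // g ≠ 1}, {p | g.1 • p = p} := by
      ext p
      simp only [Set.mem_iUnion, Set.mem_ofPred_eq]
      constructor
      · rintro ⟨g, hg, hp⟩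
        exact ⟨⟨g, hg⟩, hp⟩
      · rintro ⟨⟨g, hg⟩, hp⟩
        exact ⟨g, hg, hp⟩
    rw [this]
    refine Set.finite_iUnion ?_
    rintro ⟨g, hg⟩
    obtain ⟨p, q, hpq, h⟩ := hfix g hg
    refine (Set.toFinite {p, q}).subset ?_
    intro r hr
    simpa using (h r).1 hr
  have : Finite X := hXf
  refine count_lemma (G := G) (X := X) ?_ ?_ ?_
  · intro g hg
    obtain ⟨p, q, hpq, h⟩ := hfix g hg
    have hp : g • p = p := (h p).2 (Or.inl rfl)
    have hq : g • q = q := (h q).2 (Or.inr rfl)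
    let p' : X := ⟨p, g, hg, hp⟩
    let q' : X := ⟨q, g, hg, hq⟩
    have : MulAction.fixedBy X g = {p', q'} := by
      ext r
      rw [MulAction.mem_fixedBy, Subtype.ext_iff]
      have := h r
      simp only [Set.mem_insert_iff, Set.mem_singleton_iff, Subtype.ext_iff]
      exact this
    rw [this, Nat.card_coe_set_eq, Set.ncard_pair]
    intro h
    exact hpq (congrArg Subtype.val h)
  · rintro ⟨p, g, hg, hp⟩
    exact ⟨g, hg, Subtype.ext hp⟩
  · intro x
    have h1 : IsCyclic ((MulAction.stabilizer G x).map G.subtype) := by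
      have : Finite ((MulAction.stabilizer G x).map G.subtype) :=
        Finite.of_equiv _ ((MulAction.stabilizer G x).equivMapOfInjective _
          G.subtype_injective).toEquiv
      refine stab_cyclic _ x.1 ?_
      rintro _ ⟨g, hg, rfl⟩
      exact congrArg Subtype.val hg
    exact ((MulAction.stabilizer G x).equivMapOfInjective _ G.subtype_injective).isCyclic.2 h1


theorem rp_diag_pow {ζ : ℂ} {g : PGL2C} (h : Rp !![ζ, 0; 0, 1] g) (k : ℕ) :
    Rp !![ζ ^ k, 0; 0, 1] (g ^ k) := by
  have e : (!![ζ, 0; 0, 1] : M2) ^ k = !![ζ ^ k, 0; 0, 1] := by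
    induction k with
    | zero => simp [Matrix.one_fin_two]
    | succ n ih => 
      rw [pow_succ, ih]
      simp [Matrix.mul_fin_two, pow_succ]
  rw [← e]
  exact h.pow k

theorem rp_diag_one {ζ : ℂ} {g : PGL2C} (h : Rp !![ζ, 0; 0, 1] g) : g = 1 ↔ ζ = 1 := by
  rw [rp_one_iff h]
  constructor
  · rintro ⟨c, hc⟩
    have h0 := congrFun (congrFun hc 0) 0
    have h1 := congrFun (congrFun hc 1) 1
    simp at h0 h1
    rw [h0, h1]
  · rintro rfl
    exact ⟨1, by simp [Matrix.one_fin_two]⟩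

theorem conj_pow' {G : Type*} [Group G] (x g : G) (k : ℕ) :
    (x⁻¹ * g * x) ^ k = x⁻¹ * g ^ k * x := by
  have := conj_pow (i := k) (a := x⁻¹) (b := g)
  rwa [inv_inv] at this

theorem conj_one' {G : Type*} [Group G] (x g : G) : x⁻¹ * g * x = 1 ↔ g = 1 := by
  have := conj_eq_one_iff (a := x⁻¹) (b := g)
  rwa [inv_inv] at this

theorem rp_diag_pow_one {ζ : ℂ} {x g : PGL2C} (h : Rp !![ζ, 0; 0, 1] (x⁻¹ * g * x)) (k : ℕ) :
    ζ ^ k = 1 ↔ g ^ k = 1 := by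
  rw [← rp_diag_one (rp_diag_pow h k), conj_pow', conj_one']

theorem same_order {c c1 : PGL2C} (h1 : c ≠ 1) (hf : IsOfFinOrder c) (ho : orderOf c1 = orderOf c) :
    ∃ (i : ℕ) (ζ : ℂ) (x y : PGL2C), ζ ≠ 1 ∧ Rp !![ζ, 0; 0, 1] (x⁻¹ * c * x) ∧
      Rp !![ζ, 0; 0, 1] (y⁻¹ * c1 ^ i * y) := by
  have h2 : c1 ≠ 1 := by
    rintro rfl
    rw [orderOf_one] at ho
    exact h1 (orderOf_eq_one_iff.1 ho.symm)
  have hp : 0 < orderOf c := orderOf_pos_iff.2 hf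
  have hf1 : IsOfFinOrder c1 := orderOf_pos_iff.1 (ho ▸ hp)
  obtain ⟨x, ζ, hz, hx⟩ := diag_form h1 hf
  obtain ⟨y, ξ, hxi, hy⟩ := diag_form h2 hf1
  have hpr : IsPrimitiveRoot ξ (orderOf c) := by
    refine ⟨?_, ?_⟩
    · rw [rp_diag_pow_one hy, ← ho, pow_orderOf_eq_one]
    · intro l hl
      rw [rp_diag_pow_one hy] at hl
      rw [← ho]
      exact orderOf_dvd_of_pow_eq_one hl
  have hzm : ζ ^ orderOf c = 1 := by rw [rp_diag_pow_one hx, pow_orderOf_eq_one]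
  have : NeZero (orderOf c) := ⟨hp.ne'⟩
  obtain ⟨i, -, hi⟩ := hpr.eq_pow_of_pow_eq_one hzm
  refine ⟨i, ζ, x, y, hz, hx, ?_⟩
  rw [← conj_pow', ← hi]
  exact rp_diag_pow hy i

theorem conj_finish {G G' : Subgroup PGL2C} [Finite G] [Finite G'] (φ : G ≃* G') (x : PGL2C)
    (S : Set G) (hS : Subgroup.closure S = ⊤) (h : ∀ g ∈ S, x * (g : PGL2C) * x⁻¹ ∈ G') :
    ∃ x : PGL2C, Subgroup.map (MulAut.conj x).toMonoidHom G = G' := by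
  refine ⟨x, ?_⟩
  refine Subgroup.eq_of_le_of_card_ge ?_ ?_
  · rintro _ ⟨g, hg, rfl⟩
    have : (⟨g, hg⟩ : G) ∈ Subgroup.closure S := by rw [hS]; trivial
    have hle : Subgroup.closure S ≤ G'.comap ((MulAut.conj x).toMonoidHom.comp G.subtype) := by
      rw [Subgroup.closure_le]
      intro s hs
      exact h s hs
    exact hle this
  · rw [Subgroup.card_map_of_injective (MulAut.conj x).injective, Nat.card_congr φ.toEquiv]

theorem two_of_conj {x y g h : PGL2C} {M : M2} (h1 : Rp M (x⁻¹ * g * x)) (h2 : Rp M (y⁻¹ * h * y)) :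
    (y * x⁻¹) * g * (y * x⁻¹)⁻¹ = h := by
  have := h1.unique h2
  calc (y * x⁻¹) * g * (y * x⁻¹)⁻¹ = y * (x⁻¹ * g * x) * y⁻¹ := by group
    _ = y * (y⁻¹ * h * y) * y⁻¹ := by rw [this]
    _ = h := by group

theorem cyclic_case {G G' : Subgroup PGL2C} [Finite G] [Finite G'] (φ : G ≃* G') (hG : IsCyclic G) :
    ∃ x : PGL2C, Subgroup.map (MulAut.conj x).toMonoidHom G = G' := by
  obtain ⟨c, hc⟩ := hG.exists_generator
  have hS : Subgroup.closure {c} = ⊤ := by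
    rw [← Subgroup.zpowers_eq_closure]
    exact (Subgroup.eq_top_iff' _).2 hc
  by_cases h1 : c = 1
  · exact conj_finish φ 1 {c} hS (by simp [h1])
  obtain ⟨i, ζ, x, y, hz, hx, hy⟩ := same_order (c := (c : PGL2C)) (c1 := (φ c : PGL2C))
    (by simpa using h1) (G.subtype.isOfFinOrder (isOfFinOrder_of_finite c))
    (by rw [Subgroup.orderOf_coe, Subgroup.orderOf_coe]; exact MulEquiv.orderOf_eq φ c)
  refine conj_finish φ (y * x⁻¹) {c} hS ?_
  intro g hg
  rw [Set.mem_singleton_iff.1 hg, two_of_conj hx hy]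
  exact pow_mem (φ c).2 i

/-- Cayley–Hamilton style trace vanishing -/
theorem coef_zero {M : M2} {g : PGL2C} (h : Rp M g) (hg : g ≠ 1) {k : ℕ} (hk : g ^ k = 1)
    {u v : ℂ} (e : M ^ k = u • M + v • (1 : M2)) : u = 0 := by
  by_contra hu
  obtain ⟨c, hc⟩ := (rp_one_iff (h.pow k)).1 hk
  rw [e] at hc
  apply hg
  rw [rp_one_iff h]
  refine ⟨u⁻¹ * (c - v), ?_⟩
  rw [mul_smul, sub_smul, ← hc, add_sub_cancel_right, smul_smul, inv_mul_cancel₀ hu, one_smul]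

theorem sq_eq (M : M2) : M ^ 2 = M.trace • M + (-M.det) • (1 : M2) := by
  ext i j
  fin_cases i <;> fin_cases j <;>
    simp [sq, Matrix.mul_apply, trace_fin_two, det_fin_two] <;> ring

theorem pow_rec (M : M2) (hd : M.det = 1) {k : ℕ} {u v : ℂ} (e : M ^ k = u • M + v • (1 : M2)) :
    M ^ (k + 1) = (u * M.trace + v) • M + (-u) • (1 : M2) := by
  rw [pow_succ, e, add_mul, smul_mul_assoc, smul_mul_assoc, ← sq, sq_eq, hd, one_mul]
  module

theorem ne_one_of_order {g : PGL2C} {k : ℕ} (h : orderOf g = k) (hk : k ≠ 1) : g ≠ 1 := by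
  rintro rfl
  rw [orderOf_one] at h
  exact hk h.symm

theorem tr2 {M : M2} {g : PGL2C} (h : Rp M g) (ho : orderOf g = 2) : M.trace = 0 :=
  coef_zero h (ne_one_of_order ho (by norm_num)) (k := 2) (orderOf_dvd_iff_pow_eq_one.1 (dvd_of_eq ho)) (sq_eq M)

theorem tr3 {M : M2} {g : PGL2C} (h : Rp M g) (hd : M.det = 1) (ho : orderOf g = 3) :
    M.trace ^ 2 = 1 := by
  have := coef_zero h (ne_one_of_order ho (by norm_num)) (k := 3) (orderOf_dvd_iff_pow_eq_one.1 (dvd_of_eq ho))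
    (pow_rec M hd (sq_eq M))
  rw [hd] at this
  linear_combination this

theorem tr4 {M : M2} {g : PGL2C} (h : Rp M g) (hd : M.det = 1) (ho : orderOf g = 4) :
    M.trace ^ 2 = 2 := by
  have := coef_zero h (ne_one_of_order ho (by norm_num)) (k := 4) (orderOf_dvd_iff_pow_eq_one.1 (dvd_of_eq ho))
    (pow_rec M hd (pow_rec M hd (sq_eq M)))
  rw [hd] at this
  have h0 : M.trace ≠ 0 := by
    intro h0
    have h2 := sq_eq M
    rw [h0, zero_smul, zero_add] at h2
    have := h.pow 2
    rw [h2] at this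
    have h3 := (rp_one_iff this).2 ⟨_, rfl⟩
    have := orderOf_dvd_of_pow_eq_one h3
    rw [ho] at this
    norm_num at this
  have h5 : M.trace * (M.trace ^ 2 - 2) = 0 := by linear_combination this
  rcases mul_eq_zero.1 h5 with h | h
  · exact absurd h h0
  · linear_combination h

theorem tr5 {M : M2} {g : PGL2C} (h : Rp M g) (hd : M.det = 1) (ho : orderOf g = 5) :
    M.trace ^ 2 = M.trace + 1 ∨ M.trace ^ 2 = - M.trace + 1 := by
  have := coef_zero h (ne_one_of_order ho (by norm_num)) (k := 5) (orderOf_dvd_iff_pow_eq_one.1 (dvd_of_eq ho))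
    (pow_rec M hd (pow_rec M hd (pow_rec M hd (sq_eq M))))
  rw [hd] at this
  have h5 : (M.trace ^ 2 - (M.trace + 1)) * (M.trace ^ 2 - (- M.trace + 1)) = 0 := by
    linear_combination this
  rcases mul_eq_zero.1 h5 with h | h
  · left; linear_combination h
  · right; linear_combination h

theorem sq_one_of_tr {M : M2} {g : PGL2C} (h : Rp M g) (ht : M.trace = 0) : g ^ 2 = 1 := by
  have h2 := sq_eq M
  rw [ht, zero_smul, zero_add] at h2
  have := h.pow 2
  rw [h2] at this
  exact (rp_one_iff this).2 ⟨_, rfl⟩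

theorem Rp.neg {M : M2} {g : PGL2C} (h : Rp M g) : Rp (-M) g := by
  have := h.smul (c := -1) (by norm_num)
  rwa [neg_one_smul] at this

theorem det_neg' (M : M2) : (-M).det = M.det := by
  simp [det_fin_two]

theorem lift3 {g : PGL2C} (ho : orderOf g = 3) : ∃ M : M2, M.det = 1 ∧ M.trace = 1 ∧ Rp M g := by
  obtain ⟨M, hd, h⟩ := Rp.exdet g
  rcases mul_self_eq_one_iff.1 ((sq _).symm.trans (tr3 h hd ho)) with ht | ht
  · exact ⟨M, hd, ht, h⟩
  · exact ⟨-M, by rw [det_neg', hd], by rw [trace_neg, ht, neg_neg], h.neg⟩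

theorem lift5 {g : PGL2C} (ho : orderOf g = 5) :
    ∃ M : M2, M.det = 1 ∧ M.trace ^ 2 = M.trace + 1 ∧ Rp M g := by
  obtain ⟨M, hd, h⟩ := Rp.exdet g
  rcases tr5 h hd ho with ht | ht
  · exact ⟨M, hd, ht, h⟩
  · exact ⟨-M, by rw [det_neg', hd], by rw [trace_neg]; linear_combination ht, h.neg⟩

/-- dihedral canonical form -/
theorem dihedral_form {a c x : PGL2C} {ζ : ℂ} (hz : ζ ≠ 1) (hc : Rp !![ζ, 0; 0, 1] (x⁻¹ * c * x))
    (ha : orderOf a = 2) (hac : orderOf (a * c) = 2) :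
    ∃ y, Rp !![ζ, 0; 0, 1] (y⁻¹ * c * y) ∧ Rp !![0, 1; 1, 0] (y⁻¹ * a * y) := by
  obtain ⟨M, hM⟩ := Rp.ex (x⁻¹ * a * x)
  have hoc : ∀ g : PGL2C, orderOf (x⁻¹ * g * x) = orderOf g := by
    intro g
    have := orderOf_injective (MulAut.conj x⁻¹).toMonoidHom (MulAut.conj x⁻¹).injective g
    simpa using this
  have t1 := tr2 hM (by rw [hoc, ha])
  have hm := hM.mul hc
  have t2 := tr2 hm (by
    rw [show x⁻¹ * a * x * (x⁻¹ * c * x) = x⁻¹ * (a * c) * x by group, hoc, hac])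
  rw [trace_fin_two] at t1
  simp [trace_fin_two, Matrix.mul_apply] at t2
  have hz' : ζ - 1 ≠ 0 := sub_ne_zero.2 hz
  have e00 : M 0 0 = 0 := by
    have : (ζ - 1) * M 0 0 = 0 := by linear_combination t2 - t1
    simpa [hz'] using this
  have e11 : M 1 1 = 0 := by linear_combination t1 - e00
  have hd := hM.det_ne
  simp [det_fin_two, e00, e11] at hd
  obtain ⟨hq, hr⟩ := hd
  obtain ⟨u, hu⟩ := IsAlgClosed.exists_pow_nat_eq (M 0 1 / M 1 0) (n := 2) (by norm_num)
  have hu0 : u ≠ 0 := by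
    rintro rfl
    have := div_ne_zero hq hr
    apply this
    rw [← hu]; norm_num
  obtain ⟨k, hk⟩ := Rp.of_det (M := !![u, 0; 0, 1]) (by simp [det_fin_two, hu0])
  have hu2 : u ^ 2 * M 1 0 = M 0 1 := by rw [hu]; field_simp
  refine ⟨x * k, ?_, ?_⟩
  · have := hc.conj hk (N := !![ζ, 0; 0, 1]) (by simp [Matrix.mul_fin_two, mul_comm])
    convert this using 1; group
  · have h3 := hM.conj hk (N := !![0, u * M 1 0; u * M 1 0, 0]) (by
      ext i j
      fin_cases i <;> fin_cases j <;> simp [Matrix.mul_apply, e00, e11]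
      · linear_combination -hu2
      · ring)
    have h4 := h3.smul (inv_ne_zero (mul_ne_zero hu0 hr))
    have e : ((u * M 1 0)⁻¹ • !![0, u * M 1 0; u * M 1 0, 0] : M2) = !![0, 1; 1, 0] := by
      ext i j
      fin_cases i <;> fin_cases j <;> simp <;> field_simp
    rw [e] at h4
    convert h4 using 1; group

theorem dihedral_case {G G' : Subgroup PGL2C} [Finite G] [Finite G'] (φ : G ≃* G')
    (hG : ∃ c : G, 2 * orderOf c = Nat.card G ∧ 2 ≤ orderOf c ∧
      ∀ g, g ∉ Subgroup.zpowers c → orderOf g = 2) :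
    ∃ x : PGL2C, Subgroup.map (MulAut.conj x).toMonoidHom G = G' := by
  obtain ⟨c, h1, h2, h3⟩ := hG
  have hi : (Subgroup.zpowers c).index = 2 := by
    have := Subgroup.card_mul_index (Subgroup.zpowers c)
    rw [Nat.card_zpowers, ← h1, mul_comm] at this
    exact Nat.eq_of_mul_eq_mul_right (by omega) this
  have hne : ∃ a, a ∉ Subgroup.zpowers c := by
    by_contra! h
    rw [(Subgroup.eq_top_iff' _).2 h, Subgroup.index_top] at hi
    omega
  obtain ⟨a, ha⟩ := hne
  have hS : Subgroup.closure {c, a} = ⊤ := by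
    have hle : Subgroup.zpowers c ≤ Subgroup.closure {c, a} := by
      rw [Subgroup.zpowers_le]
      exact Subgroup.subset_closure (by simp)
    have hd := Subgroup.index_dvd_of_le hle
    rw [hi] at hd
    rcases (Nat.dvd_prime Nat.prime_two).1 hd with h | h
    · exact Subgroup.index_eq_one.1 h
    · exfalso
      have := Subgroup.relIndex_mul_index hle
      rw [hi, h] at this
      have h5 : (Subgroup.zpowers c).relIndex (Subgroup.closure {c, a}) = 1 := by omega
      exact ha (Subgroup.relIndex_eq_one.1 h5 (Subgroup.subset_closure (by simp)))
  have hc1 : c ≠ 1 := by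
    rintro rfl
    rw [orderOf_one] at h2
    omega
  obtain ⟨i, ζ, x, y, hz, hx, hy⟩ := same_order (c := (c : PGL2C)) (c1 := (φ c : PGL2C))
    (by simpa using hc1) (G.subtype.isOfFinOrder (isOfFinOrder_of_finite c))
    (by rw [Subgroup.orderOf_coe, Subgroup.orderOf_coe]; exact MulEquiv.orderOf_eq φ c)
  have key : ∀ j : ℕ, orderOf (a * c ^ j) = 2 := by
    intro j
    refine h3 _ fun h => ha ?_
    exact (Subgroup.mul_mem_cancel_right _ (Subgroup.npow_mem_zpowers c j)).1 h
  obtain ⟨x', hx1, hx2⟩ := dihedral_form (a := (a : PGL2C)) hz hx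
    (by rw [Subgroup.orderOf_coe]; exact h3 a ha)
    (by rw [← Subgroup.coe_mul, Subgroup.orderOf_coe]; simpa using key 1)
  obtain ⟨y', hy1, hy2⟩ := dihedral_form (a := (φ a : PGL2C)) hz hy
    (by rw [Subgroup.orderOf_coe]; exact (MulEquiv.orderOf_eq φ a).trans (h3 a ha))
    (by
      have : ((φ a : PGL2C) * (φ c : PGL2C) ^ i) = ((φ (a * c ^ i) : G') : PGL2C) := by simp
      rw [this, Subgroup.orderOf_coe]
      exact (MulEquiv.orderOf_eq φ _).trans (key i))
  refine conj_finish φ (y' * x'⁻¹) {c, a} hS ?_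
  rintro g (rfl | rfl)
  · rw [two_of_conj hx1 hy1]
    exact pow_mem (φ g).2 i
  · rw [two_of_conj hx2 hy2]
    exact (φ g).2


theorem eig_poly {M : M2} {v0 v1 l : ℂ} (hv : v0 ≠ 0 ∨ v1 ≠ 0)
    (e0 : M 0 0 * v0 + M 0 1 * v1 = l * v0) (e1 : M 1 0 * v0 + M 1 1 * v1 = l * v1) :
    l ^ 2 - M.trace * l + M.det = 0 := by
  rw [trace_fin_two, det_fin_two]
  rcases hv with h | h
  · refine (mul_eq_zero.1 (?_ : _ * v0 = 0)).resolve_right h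
    linear_combination (M 1 1 - l) * e0 - M 0 1 * e1
  · refine (mul_eq_zero.1 (?_ : _ * v1 = 0)).resolve_right h
    linear_combination (M 0 0 - l) * e1 - M 1 0 * e0

theorem eig_ex {A : M2} (hd : A.det = 1) (ht : A.trace = 0) :
    ∃ v0 v1 : ℂ, (v0 ≠ 0 ∨ v1 ≠ 0) ∧ A 0 0 * v0 + A 0 1 * v1 = Complex.I * v0 ∧
      A 1 0 * v0 + A 1 1 * v1 = Complex.I * v1 := by
  rw [det_fin_two] at hd
  rw [trace_fin_two] at ht
  have hI := Complex.I_sq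
  by_cases h : A 0 1 ≠ 0 ∨ Complex.I - A 0 0 ≠ 0
  · refine ⟨A 0 1, Complex.I - A 0 0, h, by ring, ?_⟩
    linear_combination -hd - hI + ht * Complex.I
  · push Not at h
    obtain ⟨h1, h2⟩ := h
    have h3 : A 0 0 = Complex.I := by linear_combination -h2
    have h4 : A 1 1 = -Complex.I := by linear_combination ht - h3
    refine ⟨2 * Complex.I, A 1 0, Or.inl (by simp), ?_, ?_⟩
    · rw [h1, h3]; ring
    · rw [h4]; ring

/-- Fricke canonical form -/
theorem fricke {A B : M2} {a b : PGL2C} {β γ : ℂ} (hA : Rp A a) (hB : Rp B b) (dA : A.det = 1)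
    (dB : B.det = 1) (tA : A.trace = 0) (tB : B.trace = β) (tAB : (A * B).trace = γ)
    (hirr : β ^ 2 + γ ^ 2 ≠ 4) :
    ∃ x : PGL2C, Rp !![Complex.I, γ + Complex.I * β; 0, -Complex.I] (x⁻¹ * a * x) ∧
      Rp !![0, -1; 1, β] (x⁻¹ * b * x) := by
  obtain ⟨v0, v1, hv, e0, e1⟩ := eig_ex dA tA
  have hI := Complex.I_sq
  have hP : (!![v0, B 0 0 * v0 + B 0 1 * v1; v1, B 1 0 * v0 + B 1 1 * v1] : M2).det ≠ 0 := by
    intro h0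
    rw [det_fin_two_of] at h0
    apply hirr
    have hl : ∃ l, B 0 0 * v0 + B 0 1 * v1 = l * v0 ∧ B 1 0 * v0 + B 1 1 * v1 = l * v1 := by
      rcases hv with h | h
      · refine ⟨(B 0 0 * v0 + B 0 1 * v1) / v0, by field_simp, ?_⟩
        field_simp
        linear_combination h0
      · refine ⟨(B 1 0 * v0 + B 1 1 * v1) / v1, ?_, by field_simp⟩
        field_simp
        linear_combination -h0
    obtain ⟨l, l0, l1⟩ := hl
    have q1 := eig_poly hv l0 l1
    have q2 := eig_poly (M := A * B) (l := Complex.I * l) hv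
      (by
        simp only [Matrix.mul_apply, Fin.sum_univ_two]
        linear_combination A 0 0 * l0 + A 0 1 * l1 + l * e0)
      (by
        simp only [Matrix.mul_apply, Fin.sum_univ_two]
        linear_combination A 1 0 * l0 + A 1 1 * l1 + l * e1)
    rw [tB, dB] at q1
    rw [tAB, det_mul, dA, dB] at q2
    have hl0 : l ≠ 0 := by
      rintro rfl
      norm_num at q1
    have q3 : 2 * l = β - Complex.I * γ := by
      apply mul_left_cancel₀ hl0
      linear_combination q1 - q2 + hI * l ^ 2
    have q4 : l * (β + Complex.I * γ) = 2 := by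
      linear_combination -q1 - q2 + hI * l ^ 2
    linear_combination (-2) * q4 * (-1) - (β + Complex.I * γ) * q3 + γ ^ 2 * hI
  obtain ⟨x, hx⟩ := Rp.of_det hP
  rw [trace_fin_two] at tA tB
  rw [det_fin_two] at dA dB
  simp only [trace_fin_two, Matrix.mul_apply, Fin.sum_univ_two] at tAB
  refine ⟨x, hA.conj hx ?_, hB.conj hx ?_⟩
  · subst tAB tB
    ext i j
    fin_cases i <;> fin_cases j <;> simp [Matrix.mul_apply]
    · linear_combination e0
    · linear_combination B 1 1 * e0 - B 0 1 * e1 - tA * (B 1 1 * v0 - B 0 1 * v1)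
    · linear_combination e1
    · linear_combination B 0 0 * e1 - B 1 0 * e0 - tA * (B 0 0 * v1 - B 1 0 * v0)
  · subst tB
    ext i j
    fin_cases i <;> fin_cases j <;> simp [Matrix.mul_apply]
    · linear_combination -dB * v0
    · linear_combination -dB * v1

/-- pair with prescribed traces -/
def Tr (a b : PGL2C) (γ : ℂ) : Prop :=
  ∃ A B : M2, Rp A a ∧ Rp B b ∧ A.det = 1 ∧ B.det = 1 ∧ A.trace = 0 ∧ B.trace = 1 ∧
    (A * B).trace = γ

theorem Tr.neg {a b : PGL2C} {γ : ℂ} (h : Tr a b γ) : Tr a b (-γ) := by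
  obtain ⟨A, B, h1, h2, h3, h4, h5, h6, h7⟩ := h
  exact ⟨-A, B, h1.neg, h2, by rw [det_neg', h3], h4, by rw [trace_neg, h5, neg_zero], h6,
    by rw [neg_mul, trace_neg, h7]⟩

theorem Tr.conj {a b a' b' : PGL2C} {γ : ℂ} (h : Tr a b γ) (h' : Tr a' b' γ) (hg : γ ^ 2 ≠ 3) :
    ∃ x, x * a * x⁻¹ = a' ∧ x * b * x⁻¹ = b' := by
  obtain ⟨A, B, h1, h2, h3, h4, h5, h6, h7⟩ := h
  obtain ⟨A', B', h1', h2', h3', h4', h5', h6', h7'⟩ := h'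
  have hi : (1 : ℂ) ^ 2 + γ ^ 2 ≠ 4 := fun h => hg (by linear_combination h)
  obtain ⟨x, hx1, hx2⟩ := fricke h1 h2 h3 h4 h5 h6 h7 hi
  obtain ⟨y, hy1, hy2⟩ := fricke h1' h2' h3' h4' h5' h6' h7' hi
  exact ⟨y * x⁻¹, two_of_conj hx1 hy1, two_of_conj hx2 hy2⟩

theorem Tr.twist {a b : PGL2C} {γ : ℂ} (h : Tr a b γ) (hg : γ ^ 2 = γ + 1) :
    ∃ x, Tr (x⁻¹ * a * x)
      (x⁻¹ * ((b * a * b * a) * b * (b * a * b * a)⁻¹) * x) (1 - γ) := by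
  obtain ⟨A, B, h1, h2, h3, h4, h5, h6, h7⟩ := h
  have hi : (1 : ℂ) ^ 2 + γ ^ 2 ≠ 4 := fun h => by
    have : γ = 2 := by linear_combination h - hg
    rw [this] at hg
    norm_num at hg
  obtain ⟨x, hx1, hx2⟩ := fricke h1 h2 h3 h4 h5 h6 h7 hi
  refine ⟨x, ?_⟩
  have hI := Complex.I_sq
  have hw := ((hx2.mul hx1).mul hx2).mul hx1
  have hb := (hw.mul hx2).mul hw.adj
  have e : x⁻¹ * ((b * a * b * a) * b * (b * a * b * a)⁻¹) * x =
    x⁻¹ * b * x * (x⁻¹ * a * x) * (x⁻¹ * b * x) * (x⁻¹ * a * x) * (x⁻¹ * b * x) *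
        (x⁻¹ * b * x * (x⁻¹ * a * x) * (x⁻¹ * b * x) * (x⁻¹ * a * x))⁻¹ := by group
  have dA : (!![Complex.I, γ + Complex.I * 1; 0, -Complex.I] : M2).det = 1 := by
    rw [det_fin_two_of]; linear_combination -hI
  have dB : (!![0, -1; 1, 1] : M2).det = 1 := by
    rw [det_fin_two_of]; norm_num
  rw [e]
  refine ⟨_, _, hx1.neg, hb, ?_, ?_, ?_, ?_, ?_⟩
  · rw [det_neg', dA]
  · simp only [det_mul, det_adjugate, dA, dB]; norm_num
  · simp [trace_fin_two]
  · rw [trace_mul_comm, ← mul_assoc, adjugate_mul]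
    simp only [det_mul, dA, dB]
    simp [trace_fin_two]
  · simp only [Matrix.mul_fin_two, adjugate_fin_two_of, Matrix.neg_of, Matrix.neg_cons,
      Matrix.neg_empty, trace_fin_two_of]
    linear_combination ((-4)*Complex.I^2*γ^1 + (-4)*Complex.I^0*γ^3 + (4)*Complex.I^0*γ^1) * hI +
      ((-1)*Complex.I^0*γ^3 + (-1)*Complex.I^0*γ^2 + (2)*Complex.I^0*γ^1 + (1)*Complex.I^0*γ^0) * hg


theorem conj_finish2 {G G' : Subgroup PGL2C} [Finite G] [Finite G'] (φ : G ≃* G') (x : PGL2C)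
    {a b : PGL2C} (hS : Subgroup.closure {a, b} = G) (ha : x * a * x⁻¹ ∈ G')
    (hb : x * b * x⁻¹ ∈ G') :
    ∃ x : PGL2C, Subgroup.map (MulAut.conj x).toMonoidHom G = G' := by
  refine ⟨x, ?_⟩
  refine Subgroup.eq_of_le_of_card_ge ?_ ?_
  · rw [Subgroup.map_le_iff_le_comap]
    conv_lhs => rw [← hS]
    rw [Subgroup.closure_le]
    rintro s (rfl | rfl)
    · exact ha
    · exact hb
  · rw [Subgroup.card_map_of_injective (MulAut.conj x).injective, Nat.card_congr φ.toEquiv]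

theorem tr_of_orders {a b : PGL2C} (ha : orderOf a = 2) (hb : orderOf b = 3) :
    ∃ (A B : M2), Rp A a ∧ Rp B b ∧ A.det = 1 ∧ B.det = 1 ∧ A.trace = 0 ∧ B.trace = 1 := by
  obtain ⟨A, dA, hA⟩ := Rp.exdet a
  obtain ⟨B, dB, tB, hB⟩ := lift3 hb
  exact ⟨A, B, hA, hB, dA, dB, tr2 hA ha, tB⟩

theorem tr_3 {a b : PGL2C} (ha : orderOf a = 2) (hb : orderOf b = 3) (hab : orderOf (a * b) = 3) :
    Tr a b 1 := by
  obtain ⟨A, B, hA, hB, dA, dB, tA, tB⟩ := tr_of_orders ha hb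
  have h := tr3 (hA.mul hB) (by rw [det_mul, dA, dB, one_mul]) hab
  have hT : Tr a b (A * B).trace := ⟨A, B, hA, hB, dA, dB, tA, tB, rfl⟩
  rcases mul_self_eq_one_iff.1 ((sq _).symm.trans h) with h | h
  · rwa [h] at hT
  · rw [h] at hT
    simpa using hT.neg

theorem tr_4 {a b : PGL2C} {s : ℂ} (hs : s ^ 2 = 2) (ha : orderOf a = 2) (hb : orderOf b = 3)
    (hab : orderOf (a * b) = 4) : Tr a b s := by
  obtain ⟨A, B, hA, hB, dA, dB, tA, tB⟩ := tr_of_orders ha hb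
  have h := tr4 (hA.mul hB) (by rw [det_mul, dA, dB, one_mul]) hab
  have hT : Tr a b (A * B).trace := ⟨A, B, hA, hB, dA, dB, tA, tB, rfl⟩
  rcases sq_eq_sq_iff_eq_or_eq_neg.1 (h.trans hs.symm) with h | h
  · rwa [h] at hT
  · rw [h] at hT
    simpa using hT.neg

theorem tr_5 {a b : PGL2C} (ha : orderOf a = 2) (hb : orderOf b = 3)
    (hab : orderOf (a * b) = 5) : ∃ γ, γ ^ 2 = γ + 1 ∧ Tr a b γ := by
  obtain ⟨A, B, hA, hB, dA, dB, tA, tB⟩ := tr_of_orders ha hb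
  have h := tr5 (hA.mul hB) (by rw [det_mul, dA, dB, one_mul]) hab
  have hT : Tr a b (A * B).trace := ⟨A, B, hA, hB, dA, dB, tA, tB, rfl⟩
  rcases h with h | h
  · exact ⟨_, h, hT⟩
  · exact ⟨_, by linear_combination h, hT.neg⟩

theorem triangle_case {G G' : Subgroup PGL2C} [Finite G] [Finite G'] (φ : G ≃* G') (a b : G)
    (ha : orderOf a = 2) (hb : orderOf b = 3)
    (hab : orderOf (a * b) = 3 ∨ orderOf (a * b) = 4 ∨ orderOf (a * b) = 5)
    (hS : Subgroup.closure {(a : PGL2C), (b : PGL2C)} = G) :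
    ∃ x : PGL2C, Subgroup.map (MulAut.conj x).toMonoidHom G = G' := by
  have o1 : orderOf (a : PGL2C) = 2 := by rw [Subgroup.orderOf_coe, ha]
  have o2 : orderOf (b : PGL2C) = 3 := by rw [Subgroup.orderOf_coe, hb]
  have o3 : orderOf ((a : PGL2C) * (b : PGL2C)) = orderOf (a * b) := by
    rw [← Subgroup.coe_mul, Subgroup.orderOf_coe]
  have p1 : orderOf (φ a : PGL2C) = 2 := by
    rw [Subgroup.orderOf_coe]; exact (MulEquiv.orderOf_eq φ a).trans ha
  have p2 : orderOf (φ b : PGL2C) = 3 := by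
    rw [Subgroup.orderOf_coe]; exact (MulEquiv.orderOf_eq φ b).trans hb
  have p3 : orderOf ((φ a : PGL2C) * (φ b : PGL2C)) = orderOf (a * b) := by
    rw [← Subgroup.coe_mul, Subgroup.orderOf_coe, ← map_mul]; exact MulEquiv.orderOf_eq φ _
  have fin : ∀ x : PGL2C, x * (a : PGL2C) * x⁻¹ = φ a ∧ x * (b : PGL2C) * x⁻¹ = φ b →
      ∃ x : PGL2C, Subgroup.map (MulAut.conj x).toMonoidHom G = G' := fun x h =>
    conj_finish2 φ x hS (by rw [h.1]; exact (φ a).2) (by rw [h.2]; exact (φ b).2)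
  rcases hab with h | h | h
  · obtain ⟨x, hx⟩ := (tr_3 o1 o2 (o3.trans h)).conj (tr_3 p1 p2 (p3.trans h)) (by norm_num)
    exact fin x hx
  · obtain ⟨s, hs⟩ := IsAlgClosed.exists_pow_nat_eq (2 : ℂ) (n := 2) (by norm_num)
    obtain ⟨x, hx⟩ := (tr_4 hs o1 o2 (o3.trans h)).conj (tr_4 hs p1 p2 (p3.trans h))
      (by rw [hs]; norm_num)
    exact fin x hx
  · obtain ⟨γ, hγ, hT⟩ := tr_5 o1 o2 (o3.trans h)
    obtain ⟨δ, hδ, hT'⟩ := tr_5 p1 p2 (p3.trans h)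
    have hne : γ ^ 2 ≠ 3 := by
      intro h3
      have : γ = 2 := by linear_combination h3 - hγ
      rw [this] at hγ
      norm_num at hγ
    have : (γ - δ) * (γ - (1 - δ)) = 0 := by linear_combination hγ - hδ
    rcases mul_eq_zero.1 this with h | h
    · rw [← sub_eq_zero.1 h] at hT'
      obtain ⟨x, hx⟩ := hT.conj hT' hne
      exact fin x hx
    · obtain ⟨y, hy⟩ := hT'.twist hδ
      rw [← sub_eq_zero.1 h] at hy
      obtain ⟨x, hx1, hx2⟩ := hT.conj hy hne
      refine conj_finish2 φ (y * x) hS ?_ ?_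
      · have e : y * x * (a : PGL2C) * (y * x)⁻¹ = φ a := by
          calc y * x * (a : PGL2C) * (y * x)⁻¹ = y * (x * a * x⁻¹) * y⁻¹ := by group
            _ = φ a := by rw [hx1]; group
        rw [e]; exact (φ a).2
      · have e : y * x * (b : PGL2C) * (y * x)⁻¹ =
            ((φ b * φ a * φ b * φ a) * φ b * (φ b * φ a * φ b * φ a)⁻¹ : G') := by
          calc y * x * (b : PGL2C) * (y * x)⁻¹ = y * (x * b * x⁻¹) * y⁻¹ := by group
            _ = _ := by
              rw [hx2]
              push_cast
              group
        rw [e]; exact Subtype.property _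

/-- a group of order 6 is not generated this way -/
theorem gen6 {H : Type*} [Group H] [Finite H] (a b : H) (ha : orderOf a = 2) (hb : orderOf b = 3)
    (hab : orderOf (a * b) = 3) : Nat.card H ≠ 6 := by
  intro hc
  have hi : (Subgroup.zpowers b).index = 2 := by
    have := Subgroup.card_mul_index (Subgroup.zpowers b)
    rw [Nat.card_zpowers, hb, hc] at this
    omega
  have h1 : (a * b) ^ 2 ∈ Subgroup.zpowers b := Subgroup.sq_mem_of_index_two hi _
  have h2 : ((a * b) ^ 2) ^ 2 ∈ Subgroup.zpowers b := pow_mem h1 2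
  have h3 : ((a * b) ^ 2) ^ 2 = a * b := by
    have : (a * b) ^ 3 = 1 := orderOf_dvd_iff_pow_eq_one.1 (dvd_of_eq hab)
    rw [← pow_mul, show 2 * 2 = 3 + 1 from rfl, pow_succ, this, one_mul]
  rw [h3] at h2
  have h4 : a ∈ Subgroup.zpowers b :=
    (Subgroup.mul_mem_cancel_right _ (Subgroup.mem_zpowers b)).1 h2
  have h5 := Subgroup.orderOf_dvd_natCard _ h4
  rw [Nat.card_zpowers, ha, hb] at h5
  norm_num at h5

theorem gen12 {G : Type*} [Group G] [Finite G] (hc : Nat.card G = 12) (a b : G)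
    (ha : orderOf a = 2) (hb : orderOf b = 3) (hab : orderOf (a * b) = 3) :
    Subgroup.closure {a, b} = ⊤ := by
  set K := Subgroup.closure {a, b} with hK
  have haK : a ∈ K := Subgroup.subset_closure (by simp)
  have hbK : b ∈ K := Subgroup.subset_closure (by simp)
  have h2 : 2 ∣ Nat.card K := ha ▸ Subgroup.orderOf_dvd_natCard _ haK
  have h3 : 3 ∣ Nat.card K := hb ▸ Subgroup.orderOf_dvd_natCard _ hbK
  have h12 : Nat.card K ∣ 12 := hc ▸ Subgroup.card_subgroup_dvd_card K
  have h6 := gen6 (⟨a, haK⟩ : K) ⟨b, hbK⟩ (by rw [Subgroup.orderOf_mk, ha])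
    (by rw [Subgroup.orderOf_mk, hb]) (by rw [MulMemClass.mk_mul_mk, Subgroup.orderOf_mk, hab])
  refine Subgroup.eq_top_of_card_eq _ ?_
  rw [hc]
  have := Nat.le_of_dvd (by norm_num) h12
  interval_cases Nat.card K <;> omega

theorem gen_big {G K : Subgroup PGL2C} [Finite G] [Finite K] (hKG : K ≤ G)
    (ho : ∀ g : G, orderOf g ≤ 5) (hc : 11 ≤ Nat.card K) :
    (Nat.card K = 12 ∧ ∀ g : K, g ≠ 1 → orderOf g = 2 ∨ orderOf g = 3) ∨
    Nat.card K = 24 ∨ Nat.card K = 60 := by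
  have hk : ∀ g : K, orderOf g ≤ 5 := by
    intro g
    have := ho ⟨g, hKG g.2⟩
    rwa [Subgroup.orderOf_mk, Subgroup.orderOf_coe] at this
  rcases classify K with h | ⟨c, h, -⟩ | h | h | h
  · obtain ⟨c, h⟩ := h.exists_generator
    have := orderOf_eq_card_of_forall_mem_zpowers h
    have := hk c
    omega
  · have := hk c
    omega
  · exact Or.inl h
  · exact Or.inr (Or.inl h.1)
  · exact Or.inr (Or.inr h.1)

theorem pair_of {G : Type*} [Group G] {b c : G} {k : ℕ} (hb : orderOf b = 3) (hc : orderOf c = k)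
    (hk : k ≠ 3) (h : (b * c) ^ 2 = 1) :
    ∃ a b : G, orderOf a = 2 ∧ orderOf b = 3 ∧ orderOf (a * b) = k := by
  refine ⟨b * c, b⁻¹, orderOf_eq_prime h ?_, by rw [orderOf_inv, hb], ?_⟩
  · intro h1
    rw [eq_inv_of_mul_eq_one_right h1, orderOf_inv, hb] at hc
    exact hk hc.symm
  · rw [← hc]
    have := orderOf_injective (MulAut.conj b).toMonoidHom (MulAut.conj b).injective c
    simpa using this

theorem trace_adj (B C : M2) : (B * C.adjugate).trace = B.trace * C.trace - (B * C).trace := by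
  simp [trace_fin_two, Matrix.mul_apply, adjugate_fin_two]
  ring

theorem mul_ne_one_of {G : Type*} [Group G] {b c : G} (h : orderOf b ≠ orderOf c) : b * c ≠ 1 := by
  intro h1
  rw [eq_inv_of_mul_eq_one_right h1, orderOf_inv] at h
  exact h rfl

theorem pair24 {G : Subgroup PGL2C} [Finite G] (b c : G) (hb : orderOf b = 3) (hc : orderOf c = 4)
    (ho : ∀ g : G, g ≠ 1 → orderOf g = 2 ∨ orderOf g = 3 ∨ orderOf g = 4) :
    ∃ a b : G, orderOf a = 2 ∧ orderOf b = 3 ∧ orderOf (a * b) = 4 := by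
  obtain ⟨B, dB, tB, hB⟩ := lift3 (g := (b : PGL2C)) (by rw [Subgroup.orderOf_coe, hb])
  obtain ⟨C, dC, hC⟩ := Rp.exdet (c : PGL2C)
  have tC := tr4 hC dC (by rw [Subgroup.orderOf_coe, hc])
  have poly : ∀ (g : G) (M : M2), Rp M (g : PGL2C) → M.det = 1 → g ≠ 1 →
      M.trace = 0 ∨ M.trace ^ 2 = 1 ∨ M.trace ^ 2 = 2 := by
    intro g M hM hd hg
    rcases ho g hg with h | h | h <;> rw [← Subgroup.orderOf_coe] at h
    · exact Or.inl (tr2 hM h)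
    · exact Or.inr (Or.inl (tr3 hM hd h))
    · exact Or.inr (Or.inr (tr4 hM hd h))
  have r1 : Rp (B * C) ((b * c : G) : PGL2C) := hB.mul hC
  have r2 : Rp (B * C.adjugate) ((b * c⁻¹ : G) : PGL2C) := hB.mul hC.adj
  have q1 := poly _ _ r1 (by rw [det_mul, dB, dC, one_mul])
    (mul_ne_one_of (by rw [hb, hc]; norm_num))
  have q2 := poly _ _ r2 (by rw [det_mul, dB, det_adjugate, dC]; norm_num)
    (mul_ne_one_of (by rw [orderOf_inv, hb, hc]; norm_num))
  have f1 : (B * C).trace = 0 → ∃ a b : G, orderOf a = 2 ∧ orderOf b = 3 ∧ orderOf (a * b) = 4 := by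
    intro h
    exact pair_of hb hc (by norm_num) (Subtype.ext (sq_one_of_tr r1 h))
  have f2 : (B * C.adjugate).trace = 0 →
      ∃ a b : G, orderOf a = 2 ∧ orderOf b = 3 ∧ orderOf (a * b) = 4 := by
    intro h
    exact pair_of hb (by rw [orderOf_inv, hc]) (by norm_num) (Subtype.ext (sq_one_of_tr r2 h))
  have ht := trace_adj B C
  rw [tB, one_mul] at ht
  rw [ht] at q2 f2
  generalize (B * C).trace = γ at *
  generalize C.trace = s at *
  rcases q1 with q1 | q1 | q1
  · exact f1 q1
  all_goals
    rcases q2 with q2 | q2 | q2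
    · exact f2 q2
    all_goals exfalso
  · have h : s * γ = 1 := by linear_combination (tC + q1 - q2) / 2
    have : (s * γ) ^ 2 = 2 := by linear_combination tC * γ ^ 2 + 2 * q1
    rw [h] at this; norm_num at this
  · have h : s * γ = 1 / 2 := by linear_combination (tC + q1 - q2) / 2
    have : (s * γ) ^ 2 = 2 := by linear_combination tC * γ ^ 2 + 2 * q1
    rw [h] at this; norm_num at this
  · have h : s * γ = 3 / 2 := by linear_combination (tC + q1 - q2) / 2
    have : (s * γ) ^ 2 = 4 := by linear_combination tC * γ ^ 2 + 2 * q1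
    rw [h] at this; norm_num at this
  · have h : s * γ = 1 := by linear_combination (tC + q1 - q2) / 2
    have : (s * γ) ^ 2 = 4 := by linear_combination tC * γ ^ 2 + 2 * q1
    rw [h] at this; norm_num at this

theorem gold {x q : ℂ} (hx : x ^ 2 = x + 1) (h : x = q) (hq : q ^ 2 ≠ q + 1) : False := by
  subst h; exact hq hx

theorem solve60 {x γ : ℂ} (hx : x ^ 2 = x + 1)
    (q1 : γ = 0 ∨ γ ^ 2 = 1 ∨ γ ^ 2 = γ + 1 ∨ γ ^ 2 = -γ + 1)
    (q2 : (x - γ) = 0 ∨ (x - γ) ^ 2 = 1 ∨ (x - γ) ^ 2 = (x - γ) + 1 ∨ (x - γ) ^ 2 = -(x - γ) + 1) :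
    γ = 0 ∨ x - γ = 0 ∨ γ = 1 ∨ x - γ = 1 := by
  rcases q1 with q1 | q1 | q1 | q1
  · exact Or.inl q1
  · rcases mul_self_eq_one_iff.1 ((sq _).symm.trans q1) with h | h
    · exact Or.inr (Or.inr (Or.inl h))
    · exfalso
      subst h
      rcases q2 with q2 | q2 | q2 | q2
      · exact gold hx (q := -1) (by linear_combination q2) (by norm_num)
      · exact gold hx (q := -1/3) (by linear_combination (q2 - hx) / 3) (by norm_num)
      · exact gold hx (q := 0) (by linear_combination (q2 - hx) / 2) (by norm_num)
      · exact gold hx (q := -1/2) (by linear_combination (q2 - hx) / 4) (by norm_num)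
  · have : (γ - x) * (γ - (1 - x)) = 0 := by linear_combination q1 - hx
    rcases mul_eq_zero.1 this with h | h
    · right; left; linear_combination -h
    · exfalso
      obtain rfl : γ = 1 - x := sub_eq_zero.1 h
      rcases q2 with q2 | q2 | q2 | q2
      · exact gold hx (q := 1/2) (by linear_combination q2 / 2) (by norm_num)
      · have : (5 : ℂ) = 1 := by linear_combination q2 - 4 * hx
        norm_num at this
      · exact gold hx (q := 5/2) (by linear_combination (-q2 + 4 * hx) / 2) (by norm_num)
      · exact gold hx (q := -3/2) (by linear_combination (q2 - 4 * hx) / 2) (by norm_num)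
  · have : (γ + x) * (γ - (x - 1)) = 0 := by linear_combination q1 - hx
    rcases mul_eq_zero.1 this with h | h
    · exfalso
      obtain rfl : γ = -x := by linear_combination h
      rcases q2 with q2 | q2 | q2 | q2
      · exact gold hx (q := 0) (by linear_combination q2 / 2) (by norm_num)
      · exact gold hx (q := -3/4) (by linear_combination (q2 - 4 * hx) / 4) (by norm_num)
      · exact gold hx (q := -3/2) (by linear_combination (q2 - 4 * hx) / 2) (by norm_num)
      · exact gold hx (q := -1/2) (by linear_combination (q2 - 4 * hx) / 6) (by norm_num)
    · right; right; right; linear_combination -h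

theorem cube_trace {B C : M2} (dC : C.det = 1) (tC : C.trace ^ 2 = C.trace + 1)
    (h : (B * C).trace = 1) (tB : B.trace = 1) : (B * C ^ 3).trace = 0 := by
  rw [pow_rec C dC (sq_eq C), dC, mul_add, trace_add, mul_smul_comm, mul_smul_comm, trace_smul,
    trace_smul, h, mul_one, tB]
  simp only [smul_eq_mul]
  linear_combination tC

theorem pair60 {G : Subgroup PGL2C} [Finite G] (b c : G) (hb : orderOf b = 3) (hc : orderOf c = 5)
    (ho : ∀ g : G, g ≠ 1 → orderOf g = 2 ∨ orderOf g = 3 ∨ orderOf g = 5) :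
    ∃ a b : G, orderOf a = 2 ∧ orderOf b = 3 ∧ orderOf (a * b) = 5 := by
  obtain ⟨B, dB, tB, hB⟩ := lift3 (g := (b : PGL2C)) (by rw [Subgroup.orderOf_coe, hb])
  obtain ⟨C, dC, tC, hC⟩ := lift5 (g := (c : PGL2C)) (by rw [Subgroup.orderOf_coe, hc])
  have poly : ∀ (g : G) (M : M2), Rp M (g : PGL2C) → M.det = 1 → g ≠ 1 →
      M.trace = 0 ∨ M.trace ^ 2 = 1 ∨ M.trace ^ 2 = M.trace + 1 ∨ M.trace ^ 2 = -M.trace + 1 := by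
    intro g M hM hd hg
    rcases ho g hg with h | h | h <;> rw [← Subgroup.orderOf_coe] at h
    · exact Or.inl (tr2 hM h)
    · exact Or.inr (Or.inl (tr3 hM hd h))
    · exact Or.inr (Or.inr (tr5 hM hd h))
  have r1 : Rp (B * C) ((b * c : G) : PGL2C) := hB.mul hC
  have r2 : Rp (B * C.adjugate) ((b * c⁻¹ : G) : PGL2C) := hB.mul hC.adj
  have r3 : Rp (B * C ^ 3) ((b * c ^ 3 : G) : PGL2C) := hB.mul (hC.pow 3)
  have r4 : Rp (B * C.adjugate ^ 3) ((b * c⁻¹ ^ 3 : G) : PGL2C) := hB.mul (hC.adj.pow 3)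
  have dC' : C.adjugate.det = 1 := by rw [det_adjugate, dC]; norm_num
  have tC' : C.adjugate.trace = C.trace := by
    simp [adjugate_fin_two, trace_fin_two, add_comm]
  have q1 := poly _ _ r1 (by rw [det_mul, dB, dC, one_mul])
    (mul_ne_one_of (by rw [hb, hc]; norm_num))
  have q2 := poly _ _ r2 (by rw [det_mul, dB, dC', one_mul])
    (mul_ne_one_of (by rw [orderOf_inv, hb, hc]; norm_num))
  have ht := trace_adj B C
  rw [tB, one_mul] at ht
  rw [ht] at q2
  have hci : orderOf c⁻¹ = 5 := by rw [orderOf_inv, hc]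
  have h3 : ∀ d : G, orderOf d = 5 → orderOf (d ^ 3) = 5 := by
    intro d hd
    rw [Nat.Coprime.orderOf_pow (by rw [hd]; norm_num), hd]
  rcases solve60 tC q1 q2 with h | h | h | h
  · exact pair_of hb hc (by norm_num) (Subtype.ext (sq_one_of_tr r1 h))
  · rw [← ht] at h
    exact pair_of hb hci (by norm_num) (Subtype.ext (sq_one_of_tr r2 h))
  · exact pair_of hb (h3 c hc) (by norm_num)
      (Subtype.ext (sq_one_of_tr r3 (cube_trace dC tC h tB)))
  · rw [← ht] at h
    exact pair_of hb (h3 _ hci) (by norm_num)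
      (Subtype.ext (sq_one_of_tr r4 (cube_trace dC' (by rw [tC', tC]) h tB)))

theorem pair12 {G : Type*} [Group G] [Finite G] (hc : Nat.card G = 12)
    (ho : ∀ g : G, g ≠ 1 → orderOf g = 2 ∨ orderOf g = 3) :
    ∃ a b : G, orderOf a = 2 ∧ orderOf b = 3 ∧ orderOf (a * b) = 3 := by
  have : Fact (Nat.Prime 3) := ⟨Nat.prime_three⟩
  have : Fact (Nat.Prime 2) := ⟨Nat.prime_two⟩
  obtain ⟨b, hb⟩ := exists_prime_orderOf_dvd_card' (G := G) 3 (by rw [hc]; norm_num)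
  obtain ⟨P, hP⟩ := Sylow.exists_subgroup_card_pow_prime (G := G) 2 (n := 2) (by rw [hc]; norm_num)
  have hP4 : Nat.card P = 4 := by rw [hP]; norm_num
  have hp2 : ∀ g ∈ P, g ≠ 1 → orderOf g = 2 := by
    intro g hg h1
    rcases ho g h1 with h | h
    · exact h
    · have := Subgroup.orderOf_dvd_natCard _ hg
      rw [h, hP4] at this
      norm_num at this
  have hsq : ∀ g ∈ P, g * g = 1 := by
    intro g hg
    by_cases h1 : g = 1
    · simp [h1]
    · rw [← sq]
      exact orderOf_dvd_iff_pow_eq_one.1 (dvd_of_eq (hp2 g hg h1))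
  have hex : ∃ a1 a2 : G, a1 ∈ P ∧ a2 ∈ P ∧ a1 ≠ 1 ∧ a2 ≠ 1 ∧ a1 ≠ a2 := by
    have : 2 < (P : Set G).ncard := by
      rw [← Nat.card_coe_set_eq]
      change 2 < Nat.card P
      omega
    have h2 : 1 < ((P : Set G) \ {1}).ncard := by
      have := Set.le_ncard_sdiff {1} (P : Set G)
      rw [Set.ncard_singleton] at this
      omega
    obtain ⟨a1, h1, a2, h2, h3⟩ := (Set.one_lt_ncard (Set.toFinite _)).1 h2
    exact ⟨a1, a2, h1.1, h2.1, h1.2, h2.2, h3⟩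
  obtain ⟨a1, a2, m1, m2, n1, n2, n12⟩ := hex
  have hb1 : b ≠ 1 := by
    rintro rfl
    simp at hb
  have hfin : ∀ a ∈ P, a ≠ 1 → orderOf (a * b) ≠ 2 →
      ∃ a b : G, orderOf a = 2 ∧ orderOf b = 3 ∧ orderOf (a * b) = 3 := by
    intro a ha h1 h2
    refine ⟨a, b, hp2 a ha h1, hb, (ho _ ?_).resolve_left h2⟩
    exact mul_ne_one_of (by rw [hp2 a ha h1, hb]; norm_num)
  by_cases c1 : orderOf (a1 * b) = 2
  swap
  · exact hfin a1 m1 n1 c1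
  by_cases c2 : orderOf (a2 * b) = 2
  swap
  · exact hfin a2 m2 n2 c2
  exfalso
  have inv1 : ∀ a ∈ P, orderOf (a * b) = 2 → a * b * a = b⁻¹ := by
    intro a ha h
    have : (a * b) ^ 2 = 1 := orderOf_dvd_iff_pow_eq_one.1 (dvd_of_eq h)
    rw [sq, ← mul_assoc] at this
    exact eq_inv_of_mul_eq_one_left this
  have e1 := inv1 a1 m1 c1
  have e2 := inv1 a2 m2 c2
  have s1 := hsq a1 m1
  have s2 := hsq a2 m2
  have i1 : a1⁻¹ = a1 := inv_eq_of_mul_eq_one_left s1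
  have i2 : a2⁻¹ = a2 := inv_eq_of_mul_eq_one_left s2
  have hcomm : (a1 * a2) * b = b * (a1 * a2) := by
    have h1 : a2 * b = b⁻¹ * a2 := by rw [← e2, mul_assoc (a2 * b), s2, mul_one]
    have h2 : a1 * b = b⁻¹ * a1 := by rw [← e1, mul_assoc (a1 * b), s1, mul_one]
    have h3 : a1 * b⁻¹ = b * a1 := by
      rw [← e1, show a1 * (a1 * b * a1) = (a1 * a1) * b * a1 by group, s1, one_mul]
    rw [mul_assoc, h1, ← mul_assoc, h3, mul_assoc]
  have h3 : a1 * a2 ≠ 1 := by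
    intro h
    exact n12 ((eq_inv_of_mul_eq_one_left h).trans i2)
  have hC : Commute (a1 * a2) b := hcomm
  have o3 := hp2 _ (P.mul_mem m1 m2) h3
  have := hC.orderOf_mul_eq_mul_orderOf_of_coprime (by rw [o3, hb]; norm_num)
  rw [o3, hb] at this
  rcases ho (a1 * a2 * b) (mul_ne_one_of (by rw [o3, hb]; norm_num)) with h | h <;> omega

/-- Two isomorphic finite subgroups of `PGL(2, ℂ)` are conjugate. -/
theorem finite_subgroups_PGL2C_isomorphic_imp_conjugate
    (G G' : Subgroup PGL2C) [Finite G] [Finite G']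
    (h : Nonempty (G ≃* G')) :
    ∃ x : PGL2C, Subgroup.map (MulAut.conj x).toMonoidHom G = G' := by
  obtain ⟨φ⟩ := h
  have : Fact (Nat.Prime 3) := ⟨Nat.prime_three⟩
  have : Fact (Nat.Prime 5) := ⟨Nat.prime_five⟩
  have kle : ∀ a b : G, Subgroup.closure {(a : PGL2C), (b : PGL2C)} ≤ G := by
    intro a b
    rw [Subgroup.closure_le]
    rintro s (rfl | rfl)
    · exact a.2
    · exact b.2
  have kfin : ∀ a b : G, Finite (Subgroup.closure {(a : PGL2C), (b : PGL2C)}) := fun a b =>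
    Finite.of_injective _ (Subgroup.inclusion_injective (kle a b))
  have kdvd : ∀ a b : G, orderOf b ∣ Nat.card (Subgroup.closure {(a : PGL2C), (b : PGL2C)}) ∧
      orderOf (a * b) ∣ Nat.card (Subgroup.closure {(a : PGL2C), (b : PGL2C)}) := by
    intro a b
    have hbm : (b : PGL2C) ∈ Subgroup.closure {(a : PGL2C), (b : PGL2C)} :=
      Subgroup.subset_closure (by simp)
    have ham : (a : PGL2C) ∈ Subgroup.closure {(a : PGL2C), (b : PGL2C)} :=
      Subgroup.subset_closure (by simp)
    have h1 := Subgroup.orderOf_dvd_natCard _ hbm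
    have h2 := Subgroup.orderOf_dvd_natCard _ (mul_mem ham hbm)
    rw [Subgroup.orderOf_coe] at h1
    rw [← Subgroup.coe_mul, Subgroup.orderOf_coe] at h2
    exact ⟨h1, h2⟩
  rcases classify G with h | h | ⟨hc, ho⟩ | ⟨hc, ⟨c, h4⟩, ho⟩ | ⟨hc, ho⟩
  · exact cyclic_case φ h
  · exact dihedral_case φ h
  · obtain ⟨a, b, ha, hb, hab⟩ := pair12 hc ho
    refine triangle_case φ a b ha hb (Or.inl hab) ?_
    have := congrArg (Subgroup.map G.subtype) (gen12 hc a b ha hb hab)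
    rw [MonoidHom.map_closure, ← MonoidHom.range_eq_map, Subgroup.range_subtype] at this
    simpa [Set.image_pair] using this
  · obtain ⟨b, hb⟩ := exists_prime_orderOf_dvd_card' (G := G) 3 (by rw [hc]; norm_num)
    obtain ⟨a, b, ha, hb, hab⟩ := pair24 b c hb h4 ho
    refine triangle_case φ a b ha hb (Or.inr (Or.inl hab)) ?_
    have := kfin a b
    obtain ⟨d1, d2⟩ := kdvd a b
    rw [hb] at d1
    rw [hab] at d2
    have hpos := Nat.card_pos (α := Subgroup.closure {(a : PGL2C), (b : PGL2C)})
    refine Subgroup.eq_of_le_of_card_ge (kle a b) ?_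
    have hle := Subgroup.card_le_of_le (kle a b)
    rcases gen_big (kle a b) (fun g => by
      by_cases h : g = 1
      · simp [h]
      · rcases ho g h with h | h | h <;> omega) (by omega) with ⟨-, h⟩ | h | h
    · exfalso
      have hbm : (b : PGL2C) ∈ Subgroup.closure {(a : PGL2C), (b : PGL2C)} :=
        Subgroup.subset_closure (by simp)
      have ham : (a : PGL2C) ∈ Subgroup.closure {(a : PGL2C), (b : PGL2C)} :=
        Subgroup.subset_closure (by simp)
      obtain ⟨z, hz⟩ : ∃ z : Subgroup.closure {(a : PGL2C), (b : PGL2C)}, orderOf z = 4 :=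
        ⟨⟨_, mul_mem ham hbm⟩, by
          rw [Subgroup.orderOf_mk, ← Subgroup.coe_mul, Subgroup.orderOf_coe, hab]⟩
      have hz1 : z ≠ 1 := by
        rintro rfl
        simp at hz
      rcases h z hz1 with h | h <;> omega
    · omega
    · omega
  · obtain ⟨b, hb⟩ := exists_prime_orderOf_dvd_card' (G := G) 3 (by rw [hc]; norm_num)
    obtain ⟨c, h5⟩ := exists_prime_orderOf_dvd_card' (G := G) 5 (by rw [hc]; norm_num)
    obtain ⟨a, b, ha, hb, hab⟩ := pair60 b c hb h5 ho
    refine triangle_case φ a b ha hb (Or.inr (Or.inr hab)) ?_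
    have := kfin a b
    obtain ⟨d1, d2⟩ := kdvd a b
    rw [hb] at d1
    rw [hab] at d2
    have hpos := Nat.card_pos (α := Subgroup.closure {(a : PGL2C), (b : PGL2C)})
    refine Subgroup.eq_of_le_of_card_ge (kle a b) ?_
    rcases gen_big (kle a b) (fun g => by
      by_cases h : g = 1
      · simp [h]
      · rcases ho g h with h | h | h <;> omega) (by omega) with ⟨h, -⟩ | h | h <;> omega
end

section
/- Let G be a nontrivial finite subgroup of PGL(2,ℂ). Call a one-dimensional ℂ-subspace W of ℂ² an irregular point of G if there exists a nontrivial element ḡ ∈ G such that some (equivalently, any) lift A ∈ GL(2,ℂ) of ḡ satisfies A(W) = W. Then the number of irregular points of G is 2 if G is cyclic, and 2 + |G| otherwise. -/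
open Matrix

lemma burnside_aux {G X : Type*} [Group G] [Fintype G] [Fintype X] [MulAction G X]
    (hG : 1 < Fintype.card G)
    (h2 : ∀ g : G, g ≠ 1 → Nat.card (MulAction.fixedBy X g) = 2)
    (hX : ∀ x : X, ∃ g : G, g ≠ 1 ∧ g • x = x) :
    Fintype.card X = 2 ∨ Fintype.card X = 2 + Fintype.card G := by
  classical
  have hB := MulAction.sum_card_fixedBy_eq_card_orbits_mul_card_group G X
  have h1 : ∑ g : G, Fintype.card (MulAction.fixedBy X g) + 2 = Fintype.card X + 2 * Fintype.card G := by
    rw [← Finset.add_sum_erase _ _ (Finset.mem_univ (1 : G)),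
      Finset.sum_congr rfl (g := fun _ => 2)]
    · have : Fintype.card (MulAction.fixedBy X (1:G)) = Fintype.card X := by
        rw [← Nat.card_eq_fintype_card, ← Nat.card_eq_fintype_card]
        simp [MulAction.fixedBy]
      rw [this, Finset.sum_const, Finset.card_erase_of_mem (Finset.mem_univ _), Finset.card_univ]
      simp only [smul_eq_mul]
      omega
    · intro g hg
      rw [← Nat.card_eq_fintype_card]
      exact h2 g (Finset.ne_of_mem_erase hg)
  have h3 : ∑ g : G, Fintype.card (MulAction.fixedBy X g) =
      ∑ x : X, (Finset.univ.filter (fun g : G => g • x = x)).card := by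
    refine Eq.trans ?_ (Finset.sum_card_bipartiteAbove_eq_sum_card_bipartiteBelow (fun (g : G) (x : X) => g • x = x))
    refine Finset.sum_congr rfl fun g _ => ?_
    rw [Fintype.card_subtype]
    rfl
  have h4 : Fintype.card X * 2 ≤ ∑ x : X, (Finset.univ.filter (fun g : G => g • x = x)).card := by
    rw [← Finset.card_univ, ← smul_eq_mul]
    refine Finset.card_nsmul_le_sum _ _ _ fun x _ => ?_
    obtain ⟨g, hg, hx⟩ := hX x
    exact Finset.one_lt_card.2 ⟨g, by simp [hx], 1, by simp, hg⟩
  have h5 : 2 ≤ Fintype.card X := by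
    have := Fintype.one_lt_card_iff_nontrivial.1 hG
    obtain ⟨g, hg⟩ := exists_ne (1 : G)
    rw [← h2 g hg, ← Nat.card_eq_fintype_card]
    exact Nat.card_le_card_of_injective _ Subtype.val_injective
  rw [← h3] at h4
  rw [hB] at h1 h4
  set r := Fintype.card (MulAction.orbitRel.Quotient G X)
  set n := Fintype.card G
  have : r < 4 := by by_contra! h; nlinarith
  have : 2 ≤ r := by by_contra! h; nlinarith
  interval_cases r <;> omega

lemma burnside_aux2 {G Ω : Type*} [Group G] [Finite G] [MulAction G Ω] [Nontrivial G] (X : Set Ω)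
    (hinv : ∀ (g : G) x, x ∈ X → g • x ∈ X)
    (h2 : ∀ g : G, g ≠ 1 → {x | x ∈ X ∧ g • x = x}.ncard = 2)
    (hX : ∀ x ∈ X, ∃ g : G, g ≠ 1 ∧ g • x = x) :
    X.ncard = 2 ∨ X.ncard = 2 + Nat.card G := by
  have hfin : X.Finite := by
    have : X ⊆ ⋃ g : {g : G // g ≠ 1}, {x | x ∈ X ∧ g.1 • x = x} := by
      intro x hx
      obtain ⟨g, hg, h⟩ := hX x hx
      exact Set.mem_iUnion.2 ⟨⟨g, hg⟩, hx, h⟩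
    refine Set.Finite.subset (Set.finite_iUnion fun g => ?_) this
    exact Set.finite_of_ncard_ne_zero (by rw [h2 g.1 g.2]; norm_num)
  let S : SubMulAction G Ω := ⟨X, fun g x hx => hinv g _ hx⟩
  have : Finite S := hfin
  let := Fintype.ofFinite S
  let := Fintype.ofFinite G
  have := burnside_aux (G := G) (X := S) (Fintype.one_lt_card) (fun g hg => by
    rw [← h2 g hg, ← Nat.card_coe_set_eq]
    refine Nat.card_congr ⟨fun x => ⟨x.1.1, x.1.2, congrArg Subtype.val x.2⟩, fun x => ⟨⟨x.1, x.2.1⟩, Subtype.ext x.2.2⟩, fun _ => rfl, fun _ => rfl⟩)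
    (fun x => by
      obtain ⟨g, hg, h⟩ := hX x.1 x.2
      exact ⟨g, hg, Subtype.ext h⟩)
  rw [← Nat.card_eq_fintype_card, ← Nat.card_eq_fintype_card] at this
  exact this

lemma two_eig (A : Matrix (Fin 2) (Fin 2) ℂ) (n : ℕ) (hn : 0 < n) (c : ℂ) (hc : c ≠ 0)
    (hA : A ^ n = c • 1) (hs : ∀ s : ℂ, A ≠ s • 1) :
    ∃ a b : ℂ, ∃ v w : Fin 2 → ℂ, a ≠ b ∧ v ≠ 0 ∧ w ≠ 0 ∧ A *ᵥ v = a • v ∧ A *ᵥ w = b • w := by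
  obtain ⟨a, ha⟩ := IsAlgClosed.exists_aeval_eq_zero ℂ A.charpoly (by
    rw [Matrix.charpoly_degree_eq_dim]; simp)
  have ha' : a * a - A.trace * a + A.det = 0 := by
    rw [Matrix.charpoly_fin_two] at ha
    simp at ha
    linear_combination ha
  have key : ∀ t : ℂ, t * t - A.trace * t + A.det = 0 → ∃ v : Fin 2 → ℂ, v ≠ 0 ∧ A *ᵥ v = t • v := by
    intro t ht
    have : (A - t • (1 : Matrix (Fin 2) (Fin 2) ℂ)).det = 0 := by
      rw [Matrix.det_fin_two] at *
      simp [Matrix.trace_fin_two] at *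
      linear_combination ht
    obtain ⟨v, hv, h⟩ := Matrix.exists_mulVec_eq_zero_iff.2 this
    refine ⟨v, hv, ?_⟩
    rw [Matrix.sub_mulVec, Matrix.smul_mulVec, Matrix.one_mulVec, sub_eq_zero] at h
    exact h
  by_cases hab : a = A.trace - a
  · exfalso
    obtain ⟨N, hN⟩ : ∃ N, N = A - a • (1 : Matrix (Fin 2) (Fin 2) ℂ) := ⟨_, rfl⟩
    have hN2 : N * N = 0 := by
      rw [hN]
      have h1 : A.trace = 2 * a := by linear_combination -hab
      have h2 : A.det = a * a := by rw [h1] at ha'; linear_combination ha'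
      rw [Matrix.trace_fin_two] at h1
      rw [Matrix.det_fin_two] at h2
      have h3 : A 1 1 = 2 * a - A 0 0 := by linear_combination h1
      rw [h3] at h2
      ext i j
      fin_cases i <;> fin_cases j <;> simp [Matrix.mul_apply, Fin.sum_univ_two, h3] <;> first | linear_combination (-h2) | ring
    have hAN : A = a • (1 : Matrix (Fin 2) (Fin 2) ℂ) + N := by rw [hN]; abel
    have hpow : ∀ m : ℕ, A ^ (m+1) = a ^ (m+1) • (1 : Matrix (Fin 2) (Fin 2) ℂ) + ((m+1 : ℂ) * a ^ m) • N := by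
      intro m
      induction m with
      | zero => simp [← hAN]
      | succ k ih =>
        rw [pow_succ, ih]
        conv_lhs => rw [hAN]
        simp only [add_mul, mul_add, smul_mul_assoc, mul_smul_comm, hN2, mul_one, one_mul, smul_zero, add_zero]
        push_cast
        module
    obtain ⟨m, rfl⟩ : ∃ m, n = m + 1 := ⟨n - 1, by omega⟩
    rw [hpow] at hA
    have ha0 : a ≠ 0 := by
      rintro rfl
      have hNN : ((m + 1 : ℂ) * 0 ^ m) • (N * N) = c • N := by
        have := congrArg (· * N) hA
        simpa using this
      rw [hN2, smul_zero] at hNN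
      have := (smul_eq_zero.1 hNN.symm).resolve_left hc
      rw [this] at hA
      have := congrFun (congrFun hA 0) 0
      simp at this
      exact hc this.symm
    have hk : ((m+1 : ℂ) * a ^ m) ≠ 0 := mul_ne_zero (by exact_mod_cast Nat.succ_ne_zero m) (pow_ne_zero _ ha0)
    have hNs : N = (((m+1 : ℂ) * a ^ m)⁻¹ * (c - a^(m+1))) • (1 : Matrix (Fin 2) (Fin 2) ℂ) := by
      rw [mul_smul, eq_inv_smul_iff₀ hk, sub_smul, ← hA]; abel
    apply hs (a + (((m+1 : ℂ) * a ^ m)⁻¹ * (c - a^(m+1))))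
    rw [add_smul, ← hNs, ← hAN]
  · obtain ⟨v, hv, h⟩ := key a ha'
    obtain ⟨w, hw, h'⟩ := key (A.trace - a) (by linear_combination ha')
    exact ⟨a, _, v, w, hab, hv, hw, h, h'⟩

lemma mv_indep (A : Matrix (Fin 2) (Fin 2) ℂ) {a b : ℂ} {v w : Fin 2 → ℂ} (hab : a ≠ b)
    (hv : v ≠ 0) (hw : w ≠ 0) (hAv : A *ᵥ v = a • v) (hAw : A *ᵥ w = b • w) :
    LinearIndependent ℂ ![v, w] := by
  rw [LinearIndependent.pair_iff]
  intro s t h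
  have h2 : A *ᵥ (s • v + t • w) = 0 := by rw [h, mulVec_zero]
  rw [mulVec_add, mulVec_smul, mulVec_smul, hAv, hAw] at h2
  have h3 : (t * (b - a)) • w = 0 := by
    have : (t * (b - a)) • w = (s • a • v + t • b • w) - a • (s • v + t • w) := by module
    rw [this, h, h2]; simp
  have ht : t = 0 := by
    rcases smul_eq_zero.1 h3 with h | h
    · exact (mul_eq_zero.1 h).resolve_right (sub_ne_zero.2 hab.symm)
    · exact absurd h hw
  subst ht
  simp [hv] at h
  exact ⟨h, rfl⟩

lemma exists_comb {v w : Fin 2 → ℂ} (hl : LinearIndependent ℂ ![v, w]) (u : Fin 2 → ℂ) :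
    ∃ x y : ℂ, x • v + y • w = u := by
  have := hl.span_eq_top_of_card_eq_finrank' (by simp)
  have hu : u ∈ Submodule.span ℂ (Set.range ![v, w]) := this ▸ Submodule.mem_top
  simp only [Matrix.range_cons, Matrix.range_empty, Set.union_empty, Set.singleton_union] at hu
  exact Submodule.mem_span_pair.1 hu

lemma map_span_eq (A : GL (Fin 2) ℂ) {a : ℂ} {v : Fin 2 → ℂ} (hv : v ≠ 0)
    (hAv : (A : Matrix (Fin 2) (Fin 2) ℂ) *ᵥ v = a • v) :
    (ℂ ∙ v).map ((A : Matrix (Fin 2) (Fin 2) ℂ).mulVecLin) = ℂ ∙ v := by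
  rw [Submodule.map_span, Set.image_singleton, mulVecLin_apply, hAv]
  apply Submodule.span_singleton_smul_eq
  rw [isUnit_iff_ne_zero]
  rintro rfl
  have h : (A⁻¹ : GL (Fin 2) ℂ).val *ᵥ (A.val *ᵥ v) = v := by
    rw [mulVec_mulVec, ← Units.val_mul, inv_mul_cancel]; simp
  rw [hAv] at h
  simp at h
  exact hv h.symm

lemma eig_of_map (A : Matrix (Fin 2) (Fin 2) ℂ) {v : Fin 2 → ℂ}
    (h : (ℂ ∙ v).map A.mulVecLin = ℂ ∙ v) : ∃ a : ℂ, A *ᵥ v = a • v := by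
  have : A *ᵥ v ∈ ℂ ∙ v := by
    have h0 : A *ᵥ v ∈ (ℂ ∙ v).map A.mulVecLin := ⟨v, Submodule.mem_span_singleton_self v, rfl⟩
    rwa [h] at h0
  obtain ⟨a, ha⟩ := Submodule.mem_span_singleton.1 this
  exact ⟨a, ha.symm⟩

lemma fixed_iff (A : GL (Fin 2) ℂ) {a b : ℂ} {v w : Fin 2 → ℂ} (hab : a ≠ b)
    (hv : v ≠ 0) (hw : w ≠ 0) (hAv : A.val *ᵥ v = a • v) (hAw : A.val *ᵥ w = b • w)
    (W : Submodule ℂ (Fin 2 → ℂ)) :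
    (Module.finrank ℂ W = 1 ∧ W.map A.val.mulVecLin = W) ↔ (W = ℂ ∙ v ∨ W = ℂ ∙ w) := by
  constructor
  · rintro ⟨h1, h2⟩
    obtain ⟨u, hu, rfl⟩ : ∃ u : Fin 2 → ℂ, u ≠ 0 ∧ W = ℂ ∙ u := by
      obtain ⟨u, hu, h⟩ := finrank_eq_one_iff'.1 h1
      refine ⟨u, by simpa using hu, le_antisymm ?_ ?_⟩
      · intro x hx
        obtain ⟨c, hc⟩ := h ⟨x, hx⟩
        exact Submodule.mem_span_singleton.2 ⟨c, congrArg Subtype.val hc⟩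
      · simp
    obtain ⟨l, hl⟩ := eig_of_map _ h2
    have hli := mv_indep A.val hab hv hw hAv hAw
    obtain ⟨x, y, rfl⟩ := exists_comb hli u
    rw [mulVec_add, mulVec_smul, mulVec_smul, hAv, hAw] at hl
    have h3 : (x * (a - l)) • v + (y * (b - l)) • w = 0 := by
      rw [← sub_eq_zero] at hl
      rw [← hl]; module
    obtain ⟨e1, e2⟩ := LinearIndependent.pair_iff.1 hli _ _ h3
    by_cases hx : x = 0
    · subst hx
      have hy : y ≠ 0 := by rintro rfl; simp at hu
      right
      rw [zero_smul, zero_add]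
      exact Submodule.span_singleton_smul_eq (isUnit_iff_ne_zero.2 hy) _
    · have hy : y = 0 := by
        by_contra hy
        apply hab
        have e1 := (mul_eq_zero.1 e1).resolve_left hx
        have e2 := (mul_eq_zero.1 e2).resolve_left hy
        linear_combination e1 - e2
      subst hy
      left
      rw [zero_smul, add_zero]
      exact Submodule.span_singleton_smul_eq (isUnit_iff_ne_zero.2 hx) _
  · rintro (rfl | rfl)
    · exact ⟨finrank_span_singleton hv, map_span_eq A hv hAv⟩
    · exact ⟨finrank_span_singleton hw, map_span_eq A hw hAw⟩

lemma mk_eq_iff (A B : GL (Fin 2) ℂ) :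
    (QuotientGroup.mk A : PGL2C) = QuotientGroup.mk B ↔ ∃ s : ℂ, s ≠ 0 ∧ B.val = s • A.val := by
  rw [QuotientGroup.eq, GeneralLinearGroup.mem_center_iff_val_mem_range_scalar]
  constructor
  · rintro ⟨s, hs⟩
    have hB : B.val = s • A.val := by
      have : B = A * (A⁻¹ * B) := by group
      conv_lhs => rw [this]
      rw [Units.val_mul, ← hs, Matrix.scalar_apply, ← Matrix.smul_one_eq_diagonal]; simp
    refine ⟨s, ?_, hB⟩
    rintro rfl
    exact B.ne_zero (by simpa using hB)
  · rintro ⟨s, hs, hB⟩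
    refine ⟨s, ?_⟩
    rw [Units.val_mul, hB, mul_smul_comm, ← Units.val_mul, inv_mul_cancel, Matrix.scalar_apply,
      ← Matrix.smul_one_eq_diagonal]; simp

/-- eigenvectors of a nontrivial finite-order element -/
lemma eig_of_mem (G : Subgroup PGL2C) [Finite G] (A : GL (Fin 2) ℂ)
    (hA : (QuotientGroup.mk A : PGL2C) ∈ G) (h1 : (QuotientGroup.mk A : PGL2C) ≠ 1) :
    ∃ a b : ℂ, ∃ v w : Fin 2 → ℂ, a ≠ b ∧ v ≠ 0 ∧ w ≠ 0 ∧
      A.val *ᵥ v = a • v ∧ A.val *ᵥ w = b • w := by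
  have hp : (QuotientGroup.mk (1 : GL (Fin 2) ℂ) : PGL2C) = QuotientGroup.mk (A ^ Nat.card G) := by
    have : (⟨_, hA⟩ : G) ^ Nat.card G = 1 := pow_card_eq_one'
    exact (congrArg Subtype.val this).symm
  obtain ⟨s, hs, h⟩ := (mk_eq_iff _ _).1 hp
  refine two_eig A.val (Nat.card G) Nat.card_pos s hs (by simpa using h) fun t ht => h1 ?_
  refine ((mk_eq_iff 1 A).2 ⟨t, ?_, by simpa using ht⟩).symm
  rintro rfl
  exact A.ne_zero (by simpa using ht)

noncomputable def actGL : GL (Fin 2) ℂ →* Equiv.Perm (Submodule ℂ (Fin 2 → ℂ)) where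
  toFun A := 
    { toFun := fun W => W.map A.val.mulVecLin
      invFun := fun W => W.map (A⁻¹).val.mulVecLin
      left_inv := fun W => by
        beta_reduce
        rw [← Submodule.map_comp, ← Matrix.mulVecLin_mul, ← Units.val_mul]; simp
      right_inv := fun W => by
        beta_reduce
        rw [← Submodule.map_comp, ← Matrix.mulVecLin_mul, ← Units.val_mul]; simp }
  map_one' := by ext1 W; simp
  map_mul' A B := by
    ext1 W
    simp [Matrix.mulVecLin_mul, Submodule.map_comp]

lemma actGL_apply (A : GL (Fin 2) ℂ) (W) : actGL A W = W.map A.val.mulVecLin := rfl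

noncomputable def actPGL : PGL2C →* Equiv.Perm (Submodule ℂ (Fin 2 → ℂ)) :=
  QuotientGroup.lift _ actGL (by
    intro A hA
    obtain ⟨s, hs, h⟩ := (mk_eq_iff 1 A).1 ((QuotientGroup.eq_one_iff A).2 hA).symm
    ext1 W
    rw [actGL_apply, h]
    simp only [Units.val_one]
    have : (s • (1 : Matrix (Fin 2) (Fin 2) ℂ)).mulVecLin = s • LinearMap.id := by
      ext1; simp
    rw [this, Submodule.map_smul _ _ _ hs]
    simp)

lemma actPGL_mk (A : GL (Fin 2) ℂ) (W) :
    actPGL (QuotientGroup.mk A) W = W.map A.val.mulVecLin := rfl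

lemma cyclic_of_fix (G : Subgroup PGL2C) [Finite G] {v w : Fin 2 → ℂ} 
    (hl : LinearIndependent ℂ ![v, w])
    (h : ∀ A : GL (Fin 2) ℂ, (QuotientGroup.mk A : PGL2C) ∈ G →
      (∃ a : ℂ, A.val *ᵥ v = a • v) ∧ (∃ b : ℂ, A.val *ᵥ w = b • w)) : IsCyclic G := by
  have hv : v ≠ 0 := hl.ne_zero 0
  have hw : w ≠ 0 := hl.ne_zero 1
  have nz : ∀ (A : GL (Fin 2) ℂ) (a : ℂ) (v : Fin 2 → ℂ), v ≠ 0 → A.val *ᵥ v = a • v → a ≠ 0 := by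
    rintro A a v hv hA rfl
    apply hv
    have h : (A⁻¹ : GL (Fin 2) ℂ).val *ᵥ (A.val *ᵥ v) = v := by
      rw [mulVec_mulVec, ← Units.val_mul, inv_mul_cancel]; simp
    rw [hA] at h
    simp at h
    exact h.symm
  let R : PGL2C → ℂ → Prop := fun g c => ∃ (A : GL (Fin 2) ℂ) (a b : ℂ), QuotientGroup.mk A = g ∧
    A.val *ᵥ v = a • v ∧ A.val *ᵥ w = b • w ∧ c = a / b
  have hfun : ∀ g c d, R g c → R g d → c = d := by
    rintro g c d ⟨A, a, b, rfl, hAv, hAw, rfl⟩ ⟨B, a', b', hB, hBv, hBw, rfl⟩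
    obtain ⟨s, hs, e⟩ := (mk_eq_iff A B).1 hB.symm
    rw [e, smul_mulVec, hAv, smul_smul] at hBv
    rw [e, smul_mulVec, hAw, smul_smul] at hBw
    have e1 := smul_left_injective ℂ hv hBv
    have e2 := smul_left_injective ℂ hw hBw
    rw [← e1, ← e2, mul_div_mul_left _ _ hs]
  have hmul : ∀ g k c d, R g c → R k d → R (g * k) (c * d) := by
    rintro g k c d ⟨A, a, b, rfl, hAv, hAw, rfl⟩ ⟨B, a', b', rfl, hBv, hBw, rfl⟩
    refine ⟨A * B, a * a', b * b', rfl, ?_, ?_, by rw [div_mul_div_comm]⟩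
    · rw [Units.val_mul, ← mulVec_mulVec, hBv, mulVec_smul, hAv, smul_smul, mul_comm]
    · rw [Units.val_mul, ← mulVec_mulVec, hBw, mulVec_smul, hAw, smul_smul, mul_comm]
  have h1 : R 1 1 := ⟨1, 1, 1, rfl, by simp, by simp, by simp⟩
  have hinj : ∀ g, R g 1 → g = 1 := by
    rintro g ⟨A, a, b, rfl, hAv, hAw, e⟩
    have hb := nz A b w hw hAw
    have hab : a = b := by field_simp at e; exact e.symm
    subst hab
    refine ((mk_eq_iff 1 A).2 ⟨a, hb, ?_⟩).symm
    apply Matrix.mulVec_injective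
    ext1 u
    obtain ⟨x, y, rfl⟩ := exists_comb hl u
    simp only [Units.val_one, smul_mulVec, one_mulVec]
    rw [mulVec_add, mulVec_smul, mulVec_smul, hAv, hAw]
    module
  have hex : ∀ g : G, ∃ c, R g c := by
    rintro ⟨g, hg⟩
    obtain ⟨A, rfl⟩ := QuotientGroup.mk_surjective g
    obtain ⟨⟨a, ha⟩, ⟨b, hb⟩⟩ := h A hg
    exact ⟨a / b, A, a, b, rfl, ha, hb, rfl⟩
  choose χ hχ using hex
  let f : G →* ℂ :=
    { toFun := χ
      map_one' := hfun _ _ _ (hχ 1) h1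
      map_mul' := fun g k => hfun _ _ _ (hχ (g * k)) (hmul _ _ _ _ (hχ g) (hχ k)) }
  have hf : Function.Injective f := by
    intro g k hgk
    have h2 : f (g * k⁻¹) = 1 := by
      rw [map_mul, hgk, ← map_mul, mul_inv_cancel, map_one]
    have h3 := hinj _ (h2 ▸ hχ (g * k⁻¹) : R (g * k⁻¹ : G) 1)
    have : g * k⁻¹ = 1 := Subtype.ext h3
    exact mul_inv_eq_one.1 this
  exact isCyclic_of_injective_ringHom f hf

theorem card_irregular_points_of_finite_subgroup_PGL2C
    (G : Subgroup PGL2C) [Finite G] (hG : G ≠ ⊥) :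
    (IsCyclic G →
      {W : Submodule ℂ (Fin 2 → ℂ) |
          Module.finrank ℂ W = 1 ∧
          ∃ A : GL (Fin 2) ℂ, (QuotientGroup.mk A : PGL2C) ∈ G ∧
            (QuotientGroup.mk A : PGL2C) ≠ 1 ∧
            W.map ((A : Matrix (Fin 2) (Fin 2) ℂ).mulVecLin) = W}.ncard = 2) ∧
    (¬ IsCyclic G →
      {W : Submodule ℂ (Fin 2 → ℂ) |
          Module.finrank ℂ W = 1 ∧
          ∃ A : GL (Fin 2) ℂ, (QuotientGroup.mk A : PGL2C) ∈ G ∧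
            (QuotientGroup.mk A : PGL2C) ≠ 1 ∧
            W.map ((A : Matrix (Fin 2) (Fin 2) ℂ).mulVecLin) = W}.ncard
        = 2 + Nat.card G) := by
  have hne : ∀ {v w : Fin 2 → ℂ}, LinearIndependent ℂ ![v, w] → (ℂ ∙ v) ≠ (ℂ ∙ w) := by
    intro v w hl e
    have : v ∈ ℂ ∙ w := e ▸ Submodule.mem_span_singleton_self v
    obtain ⟨c, hc⟩ := Submodule.mem_span_singleton.1 this
    have := LinearIndependent.pair_iff.1 hl 1 (-c) (by rw [← hc]; module)
    exact one_ne_zero this.1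
  set X := {W : Submodule ℂ (Fin 2 → ℂ) |
          Module.finrank ℂ W = 1 ∧
          ∃ A : GL (Fin 2) ℂ, (QuotientGroup.mk A : PGL2C) ∈ G ∧
            (QuotientGroup.mk A : PGL2C) ≠ 1 ∧
            W.map ((A : Matrix (Fin 2) (Fin 2) ℂ).mulVecLin) = W} with hXdef
  let : MulAction G (Submodule ℂ (Fin 2 → ℂ)) :=
    MulAction.compHom _ (actPGL.comp G.subtype)
  have hsmul : ∀ (g : G) (W : Submodule ℂ (Fin 2 → ℂ)), g • W = actPGL g W := fun _ _ => rfl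
  have : Nontrivial G := (Subgroup.nontrivial_iff_ne_bot G).2 hG
  have hX : ∀ W, W ∈ X ↔ Module.finrank ℂ W = 1 ∧ ∃ g : G, g ≠ 1 ∧ g • W = W := by
    intro W
    refine and_congr_right fun _ => ⟨?_, ?_⟩
    · rintro ⟨A, hA, h1, h⟩
      exact ⟨⟨_, hA⟩, fun e => h1 (congrArg Subtype.val e), h⟩
    · rintro ⟨⟨g, hg⟩, h1, h⟩
      obtain ⟨A, rfl⟩ := QuotientGroup.mk_surjective g
      exact ⟨A, hg, fun e => h1 (Subtype.ext e), h⟩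
  have hfix : ∀ g : G, g ≠ 1 → ∃ v w : Fin 2 → ℂ, LinearIndependent ℂ ![v, w] ∧
      {W | W ∈ X ∧ g • W = W} = {ℂ ∙ v, ℂ ∙ w} := by
    intro g hg1
    obtain ⟨g, hg⟩ := g
    obtain ⟨A, rfl⟩ := QuotientGroup.mk_surjective g
    obtain ⟨a, b, v, w, hab, hv, hw, hAv, hAw⟩ := eig_of_mem G A hg (fun e => hg1 (Subtype.ext e))
    refine ⟨v, w, mv_indep _ hab hv hw hAv hAw, ?_⟩
    ext W
    have := fixed_iff A hab hv hw hAv hAw W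
    simp only [Set.mem_ofPred_eq, Set.mem_insert_iff, Set.mem_singleton_iff]
    rw [← this]
    constructor
    · rintro ⟨h1, h2⟩
      exact ⟨h1.1, h2⟩
    · rintro ⟨h1, h2⟩
      exact ⟨(hX W).2 ⟨h1, _, hg1, h2⟩, h2⟩
  have hfix2 : ∀ g : G, g ≠ 1 → {W | W ∈ X ∧ g • W = W}.ncard = 2 := by
    intro g hg
    obtain ⟨v, w, hl, e⟩ := hfix g hg
    rw [e, Set.ncard_pair (hne hl)]
  constructor
  · rintro ⟨g, hgen⟩
    have hg1 : g ≠ 1 := by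
      rintro rfl
      obtain ⟨k, hk⟩ := exists_ne (1 : G)
      have := hgen k
      simp at this
      exact hk this.symm
    refine Eq.trans (congrArg Set.ncard ?_) (hfix2 g hg1)
    refine Set.Subset.antisymm ?_ fun W h => h.1
    intro W hW
    obtain ⟨h1, k, hk, h⟩ := (hX W).1 hW
    have hsub : {W | W ∈ X ∧ g • W = W} ⊆ {W | W ∈ X ∧ k • W = W} := by
      rintro U ⟨hU, hgU⟩
      refine ⟨hU, ?_⟩
      have : Subgroup.zpowers g ≤ MulAction.stabilizer G U := by
        rw [Subgroup.zpowers_le]; exact hgU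
      exact this (hgen k)
    have := Set.eq_of_subset_of_ncard_le hsub (by rw [hfix2 g hg1, hfix2 k hk])
      (Set.finite_of_ncard_ne_zero (by rw [hfix2 k hk]; norm_num))
    rw [this]
    exact ⟨hW, h⟩
  · intro hnc
    refine (burnside_aux2 (G := G) X ?_ hfix2 fun W hW => ((hX W).1 hW).2).resolve_left ?_
    · intro g W hW
      obtain ⟨h1, k, hk, h⟩ := (hX W).1 hW
      refine (hX _).2 ⟨?_, g * k * g⁻¹, ?_, ?_⟩
      · obtain ⟨g, hg⟩ := g
        obtain ⟨A, rfl⟩ := QuotientGroup.mk_surjective g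
        change Module.finrank ℂ (W.map A.val.mulVecLin) = 1
        rw [← h1]
        refine (Submodule.equivMapOfInjective A.val.mulVecLin ?_ W).symm.finrank_eq
        exact Matrix.mulVec_injective_of_isUnit A.isUnit
      · simpa [mul_inv_eq_one] using hk
      · rw [mul_smul, mul_smul, inv_smul_smul, h]
    · intro hX2
      apply hnc
      have hXf : X.Finite := Set.finite_of_ncard_ne_zero (by rw [hX2]; norm_num)
      have hall : ∀ g : G, ∀ W ∈ X, g • W = W := by
        intro g W hW
        by_cases hg : g = 1
        · subst hg; exact one_smul _ _
        have : {W | W ∈ X ∧ g • W = W} = X := Set.eq_of_subset_of_ncard_le (fun W h => h.1)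
          (by rw [hfix2 g hg, hX2]) hXf
        rw [← this] at hW
        exact hW.2
      obtain ⟨g, hg⟩ := exists_ne (1 : G)
      obtain ⟨v, w, hl, e⟩ := hfix g hg
      have hvX : (ℂ ∙ v) ∈ X := (e.symm ▸ Set.mem_insert _ _ : (ℂ ∙ v) ∈ {W | W ∈ X ∧ g • W = W}).1
      have hwX : (ℂ ∙ w) ∈ X := (e.symm ▸ Set.mem_insert_of_mem _ rfl : (ℂ ∙ w) ∈ {W | W ∈ X ∧ g • W = W}).1
      refine cyclic_of_fix G hl fun A hA => ⟨?_, ?_⟩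
      · exact eig_of_map _ (hall ⟨_, hA⟩ _ hvX)
      · exact eig_of_map _ (hall ⟨_, hA⟩ _ hwX)
end
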